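/- Wronski relation: for every integer K ≥ 1, every function F : ℂ^m × ℂ^r → ℂ, and every point (x, y) ∈ ℂ^m × ℂ^r that is admissible for the identity (every bracket value occurring in a denominator of any coefficient of the iterated sums is nonzero), one has Σ_{k+l=K, k,l ≥ 0} [kκ + lδ] · (D_{m,r}^{(k)} (H_{m,r}^{(l)} F))(x; y) = 0. -/

import Mathlib

open Finset

/-- Shifted factorial `[x; a]_k` for `k ∈ ℤ`:
`[x; a]_k = [x][x+a]⋯[x+(k-1)a]` for `k ≥ 0` and `[x; a]_{-k} = 1/[x-ka; a]_k`. -/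
noncomputable def sfac (br : ℂ → ℂ) (a x : ℂ) (k : ℤ) : ℂ :=
  if 0 ≤ k then ∏ i ∈ Finset.range k.toNat, br (x + (i : ℂ) * a)
  else (∏ i ∈ Finset.range (-k).toNat, br (x + ((k : ℂ) + (i : ℂ)) * a))⁻¹

/-- The coefficient `C_{μ,I}(x; y; a, b)`. -/
noncomputable def Coef (br : ℂ → ℂ) (a b : ℂ) {m r : ℕ} (μ : Fin m → ℕ)
    (I : Finset (Fin r)) (x : Fin m → ℂ) (y : Fin r → ℂ) : ℂ :=
  (-1 : ℂ) ^ I.card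
    * (∏ i : Fin m, ∏ j : Fin m,
        if i < j then br (x i - x j + ((μ i : ℂ) - (μ j : ℂ)) * a) / br (x i - x j) else 1)
    * (∏ i ∈ I, ∏ j ∈ Iᶜ, br (y i - y j - a) / br (y i - y j))
    * (∏ i : Fin m, ∏ j : Fin m,
        sfac br a (x i - x j + b) (μ i : ℤ) / sfac br a (x i - x j + a) (μ i : ℤ))
    * ∏ i : Fin m,
        ((∏ j ∈ I, br (x i - y j - b) / br (x i - y j + (μ i : ℂ) * a))
          * ∏ j ∈ Iᶜ, br (x i - y j - a) / br (x i - y j + ((μ i : ℂ) - 1) * a))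

/-- Index set of the sums: pairs `(μ, I)` with `μ ∈ ℤ_{≥0}^m`, `I ⊆ {1,…,r}`, `|μ|+|I| = k`. -/
def idxSet (m r k : ℕ) : Finset ((Fin m → ℕ) × Finset (Fin r)) :=
  ((Fintype.piFinset fun _ : Fin m => Finset.range (k + 1)) ×ˢ
      (Finset.univ : Finset (Finset (Fin r)))).filter
    fun p => (∑ i, p.1 i) + p.2.card = k

def xshift (c : ℂ) {m : ℕ} (μ : Fin m → ℕ) (x : Fin m → ℂ) : Fin m → ℂ :=
  fun i => x i + c * (μ i : ℂ)

def xshiftI (c : ℂ) {m : ℕ} (I : Finset (Fin m)) (x : Fin m → ℂ) : Fin m → ℂ :=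
  fun i => x i + c * (if i ∈ I then 1 else 0)

def yshift (c : ℂ) {r : ℕ} (I : Finset (Fin r)) (y : Fin r → ℂ) : Fin r → ℂ :=
  fun j => y j - c * (if j ∈ I then 1 else 0)

def yshiftMu (c : ℂ) {r : ℕ} (μ : Fin r → ℕ) (y : Fin r → ℂ) : Fin r → ℂ :=
  fun j => y j - c * (μ j : ℂ)

/-- The deformed elliptic Ruijsenaars operator `H_{m,r}^{(k)}`. -/
noncomputable def Hop (br : ℂ → ℂ) (δ κ : ℂ) (m r k : ℕ)
    (F : (Fin m → ℂ) → (Fin r → ℂ) → ℂ) (x : Fin m → ℂ) (y : Fin r → ℂ) : ℂ :=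
  ∑ p ∈ idxSet m r k, Coef br δ κ p.1 p.2 x y * F (xshift δ p.1 x) (yshift κ p.2 y)

/-- The operator `D_{m,r}^{(k)}`. -/
noncomputable def Dop (br : ℂ → ℂ) (δ κ : ℂ) (m r k : ℕ)
    (F : (Fin m → ℂ) → (Fin r → ℂ) → ℂ) (x : Fin m → ℂ) (y : Fin r → ℂ) : ℂ :=
  ∑ p ∈ idxSet r m k, Coef br (-κ) (-δ) p.1 p.2 y x * F (xshiftI δ p.2 x) (yshiftMu κ p.1 y)

/-- The operator `Ĥ_{m,r}^{(k)}`. -/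
noncomputable def Hhat (br : ℂ → ℂ) (δ κ : ℂ) (m r k : ℕ)
    (F : (Fin m → ℂ) → (Fin r → ℂ) → ℂ) (x : Fin m → ℂ) (y : Fin r → ℂ) : ℂ :=
  ∑ p ∈ idxSet m r k,
    Coef br (-δ) (-κ) p.1 p.2 (fun i => x i - δ) (fun j => y j + κ)
      * F (xshift (-δ) p.1 x) (yshift (-κ) p.2 y)

/-- The operator `D̂_{m,r}^{(k)}`. -/
noncomputable def Dhat (br : ℂ → ℂ) (δ κ : ℂ) (m r k : ℕ)
    (F : (Fin m → ℂ) → (Fin r → ℂ) → ℂ) (x : Fin m → ℂ) (y : Fin r → ℂ) : ℂ :=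
  ∑ p ∈ idxSet r m k,
    Coef br κ δ p.1 p.2 (fun j => y j + κ) (fun i => x i - δ)
      * F (xshiftI (-δ) p.2 x) (yshiftMu (-κ) p.1 y)

/-- Nonvanishing of all bracket values occurring in denominators of `C_{μ,I}(x; y; a, b)`. -/
def CDenomNZ (br : ℂ → ℂ) (a : ℂ) {m r : ℕ} (μ : Fin m → ℕ)
    (I : Finset (Fin r)) (x : Fin m → ℂ) (y : Fin r → ℂ) : Prop :=
  (∀ i j : Fin m, i < j → br (x i - x j) ≠ 0)
    ∧ (∀ i ∈ I, ∀ j ∈ Iᶜ, br (y i - y j) ≠ 0)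
    ∧ (∀ i j : Fin m, sfac br a (x i - x j + a) (μ i : ℤ) ≠ 0)
    ∧ (∀ i : Fin m, ∀ j ∈ I, br (x i - y j + (μ i : ℂ) * a) ≠ 0)
    ∧ (∀ i : Fin m, ∀ j ∈ Iᶜ, br (x i - y j + ((μ i : ℂ) - 1) * a) ≠ 0)


/-- A nonzero entire function does not vanish near a point, except possibly at the point. -/
theorem eventually_ne_zero_of_entire {f : ℂ → ℂ} (hent : Differentiable ℂ f) (hnz : f ≠ 0)
    (a : ℂ) : ∀ᶠ z in nhdsWithin a {a}ᶜ, f z ≠ 0 := by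
  have han : AnalyticOnNhd ℂ f Set.univ := fun z _ => hent.analyticAt z
  rcases (hent.analyticAt a).eventually_eq_zero_or_eventually_ne_zero with h | h
  · exact absurd (funext fun z => han.eqOn_zero_of_preconnected_of_eventuallyEq_zero
      isPreconnected_univ (Set.mem_univ a) h (Set.mem_univ z)) hnz
  · exact h

/-- A nonzero entire function does not vanish at small nonzero displacements along a line. -/
theorem eventually_ne_zero_along_line {f : ℂ → ℂ} (hent : Differentiable ℂ f) (hnz : f ≠ 0)
    (a : ℂ) {b : ℂ} (hb : b ≠ 0) : ∀ᶠ s in nhdsWithin (0 : ℂ) {0}ᶜ, f (a + s * b) ≠ 0 := by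
  refine eventually_ne_zero_of_entire (f := fun s => f (a + s * b)) (by fun_prop) ?_ 0
  intro h
  apply hnz
  funext z
  have := congrFun h ((z - a) / b)
  simpa [div_mul_cancel₀ _ hb] using this

theorem bracket_zero {br : ℂ → ℂ} (hodd : ∀ z : ℂ, br (-z) = -br z) : br 0 = 0 := by
  have h := hodd 0
  rw [neg_zero] at h
  linear_combination h / 2

/-- The three-term relation forces a simple zero at the origin. -/
theorem deriv_bracket_zero_ne_zero {br : ℂ → ℂ}
    (hent : Differentiable ℂ br) (hnz : br ≠ 0)
    (hW : ∀ a b c d : ℂ,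
      br (a + b) * br (a - b) * br (c + d) * br (c - d)
        + br (a + d) * br (a - d) * br (b + c) * br (b - c)
        = br (a + c) * br (a - c) * br (b + d) * br (b - d)) :
    deriv br 0 ≠ 0 := by
  have hnot : ¬ ∀ᶠ z in nhds (0 : ℂ), br z = 0 := fun h => by
    obtain ⟨z, h1, h2⟩ := ((h.filter_mono nhdsWithin_le_nhds).and
      (eventually_ne_zero_of_entire hent hnz 0)).exists
    exact h2 h1
  obtain ⟨p, g, hg, hg0, hp⟩ :=
    ((hent.analyticAt 0).exists_eventuallyEq_pow_smul_nonzero_iff).2 hnot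
  simp only [sub_zero, smul_eq_mul] at hp
  have hscale : ∀ n : ℂ, Filter.Tendsto (fun s : ℂ => s * n) (nhds 0) (nhds 0) := fun n => by
    have : Continuous fun s : ℂ => s * n := by fun_prop
    simpa using this.tendsto 0
  have hbr : ∀ n : ℂ, ∀ᶠ s in nhdsWithin (0 : ℂ) {0}ᶜ,
      br (s * n) = s ^ p * (n ^ p * g (s * n)) := fun n => by
    filter_upwards [((hscale n).eventually hp).filter_mono nhdsWithin_le_nhds] with s hs
    rw [hs, mul_pow]; ring
  have hlim : ∀ n : ℂ, Filter.Tendsto (fun s : ℂ => n ^ p * g (s * n))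
      (nhdsWithin 0 {0}ᶜ) (nhds (n ^ p * g 0)) := fun n =>
    ((hg.continuousAt.tendsto.comp (hscale n)).mono_left nhdsWithin_le_nhds).const_mul _
  have hrel : ∀ᶠ s in nhdsWithin (0 : ℂ) {0}ᶜ,
      ((42 : ℂ) ^ p * g (s * 42)) * (28 ^ p * g (s * 28)) * (5 ^ p * g (s * 5))
          * (5 ^ p * g (s * 5))
        + (35 ^ p * g (s * 35)) * (35 ^ p * g (s * 35)) * (12 ^ p * g (s * 12))
          * (2 ^ p * g (s * 2))
        - (40 ^ p * g (s * 40)) * (30 ^ p * g (s * 30)) * (7 ^ p * g (s * 7))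
          * (7 ^ p * g (s * 7)) = 0 := by
    filter_upwards [hbr 42, hbr 28, hbr 5, hbr 35, hbr 12, hbr 2, hbr 40, hbr 30, hbr 7,
      self_mem_nhdsWithin] with s h42 h28 h5 h35 h12 h2 h40 h30 h7 hs
    have hs0 : s ≠ 0 := hs
    have h := hW (s * 35) (s * 7) (s * 5) (s * 0)
    simp only [← mul_add, ← mul_sub] at h
    norm_num [h42, h28, h5, h35, h12, h2, h40, h30, h7] at h
    have hs4 : s ^ p * s ^ p * s ^ p * s ^ p ≠ 0 := by positivity
    apply mul_left_cancel₀ hs4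
    linear_combination h
  have hA := (((hlim 42).mul (hlim 28)).mul (hlim 5)).mul (hlim 5)
  have hB := (((hlim 35).mul (hlim 35)).mul (hlim 12)).mul (hlim 2)
  have hC := (((hlim 40).mul (hlim 30)).mul (hlim 7)).mul (hlim 7)
  have hzero := tendsto_nhds_unique ((hA.add hB).sub hC)
    (tendsto_const_nhds.congr' (hrel.mono fun s hs => hs.symm))
  have hpow : (29400 : ℂ) ^ p * g 0 ^ 4 * (2 - 2 ^ p) = 0 := by
    have e1 : (29400 : ℂ) ^ p = 42 ^ p * 28 ^ p * 5 ^ p * 5 ^ p := by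
      rw [← mul_pow, ← mul_pow, ← mul_pow]; norm_num
    have e2 : (29400 : ℂ) ^ p = 35 ^ p * 35 ^ p * 12 ^ p * 2 ^ p := by
      rw [← mul_pow, ← mul_pow, ← mul_pow]; norm_num
    have e3 : (29400 : ℂ) ^ p * 2 ^ p = 40 ^ p * 30 ^ p * 7 ^ p * 7 ^ p := by
      rw [← mul_pow, ← mul_pow, ← mul_pow, ← mul_pow]; norm_num
    linear_combination hzero + g 0 ^ 4 * e1 + g 0 ^ 4 * e2 - g 0 ^ 4 * e3
  have h2p : (2 : ℂ) ^ p = 2 ^ 1 := by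
    have : (29400 : ℂ) ^ p * g 0 ^ 4 ≠ 0 :=
      mul_ne_zero (pow_ne_zero _ (by norm_num)) (pow_ne_zero _ hg0)
    linear_combination -(mul_eq_zero.1 hpow).resolve_left this
  have hp1 : p = 1 := Nat.pow_right_injective (le_refl 2) (by exact_mod_cast h2p)
  subst hp1
  have hd := ((hasDerivAt_id (0 : ℂ)).mul hg.differentiableAt.hasDerivAt).congr_of_eventuallyEq
    (f₁ := br) (hp.mono fun z hz => by simpa using hz)
  rw [hd.deriv]
  simpa using hg0

/-- A product over ordered pairs, grouped by unordered pairs. -/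
theorem prod_prod_eq_prod_lt {n : ℕ} (a : Fin n → Fin n → ℂ) (ha : ∀ i, a i i = 1) :
    ∏ i, ∏ j, a i j = ∏ i, ∏ j, if i < j then a i j * a j i else 1 := by
  have h1 : ∀ i j, a i j = (if i < j then a i j else 1) * (if j < i then a i j else 1) := by
    intro i j
    rcases lt_trichotomy i j with h | h | h
    · simp [h, h.not_gt]
    · simp [h, ha]
    · simp [h, h.not_gt]
  calc ∏ i, ∏ j, a i j
      = (∏ i, ∏ j, if i < j then a i j else 1) * ∏ i, ∏ j, if j < i then a i j else 1 := by
        simp_rw [← prod_mul_distrib, ← h1]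
    _ = (∏ i, ∏ j, if i < j then a i j else 1) * ∏ i, ∏ j, if i < j then a j i else 1 := by
        congr 1; exact prod_comm
    _ = _ := by
        simp_rw [← prod_mul_distrib]
        refine prod_congr rfl fun i _ => prod_congr rfl fun j _ => ?_
        split_ifs <;> simp

/-- The three-term relation as the evaluation of a two by two Frobenius determinant. -/
theorem three_term_det {br : ℂ → ℂ}
    (hW : ∀ a b c d : ℂ,
      br (a + b) * br (a - b) * br (c + d) * br (c - d)
        + br (a + d) * br (a - d) * br (b + c) * br (b - c)
        = br (a + c) * br (a - c) * br (b + d) * br (b - d)) (c w z w₀ z₀ : ℂ) :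
    br (c + (w - z)) * br (c + (w₀ - z₀)) * br (w - z₀) * br (w₀ - z)
      = br (c + (w - z₀)) * br (c + (w₀ - z)) * br (w - z) * br (w₀ - z₀)
        + br (c + (w₀ - z₀) + (w - z)) * br c * br (w - w₀) * br (z₀ - z) := by
  have h := hW ((2 * c + w + w₀ - z - z₀) / 2) ((w + w₀ - z₀ - z) / 2)
    ((w - z - w₀ + z₀) / 2) ((w - w₀ - z₀ + z) / 2)
  rw [show (2 * c + w + w₀ - z - z₀) / 2 + (w + w₀ - z₀ - z) / 2
      = c + (w₀ - z₀) + (w - z) by ring,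
    show (2 * c + w + w₀ - z - z₀) / 2 - (w + w₀ - z₀ - z) / 2 = c by ring,
    show (w - z - w₀ + z₀) / 2 + (w - w₀ - z₀ + z) / 2 = w - w₀ by ring,
    show (w - z - w₀ + z₀) / 2 - (w - w₀ - z₀ + z) / 2 = z₀ - z by ring,
    show (2 * c + w + w₀ - z - z₀) / 2 + (w - w₀ - z₀ + z) / 2 = c + (w - z₀) by ring,
    show (2 * c + w + w₀ - z - z₀) / 2 - (w - w₀ - z₀ + z) / 2 = c + (w₀ - z) by ring,
    show (w + w₀ - z₀ - z) / 2 + (w - z - w₀ + z₀) / 2 = w - z by ring,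
    show (w + w₀ - z₀ - z) / 2 - (w - z - w₀ + z₀) / 2 = w₀ - z₀ by ring,
    show (2 * c + w + w₀ - z - z₀) / 2 + (w - z - w₀ + z₀) / 2 = c + (w - z) by ring,
    show (2 * c + w + w₀ - z - z₀) / 2 - (w - z - w₀ + z₀) / 2 = c + (w₀ - z₀) by ring,
    show (w + w₀ - z₀ - z) / 2 + (w - w₀ - z₀ + z) / 2 = w - z₀ by ring,
    show (w + w₀ - z₀ - z) / 2 - (w - w₀ - z₀ + z) / 2 = w₀ - z by ring] at h
  linear_combination -h

/-- The Frobenius determinant evaluation. -/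
theorem frobenius_det {br : ℂ → ℂ}
    (hent : Differentiable ℂ br) (hnz : br ≠ 0)
    (hW : ∀ a b c d : ℂ,
      br (a + b) * br (a - b) * br (c + d) * br (c - d)
        + br (a + d) * br (a - d) * br (b + c) * br (b - c)
        = br (a + c) * br (a - c) * br (b + d) * br (b - d)) (n : ℕ) :
    ∀ (W Z : Fin n → ℂ) (_ : ∀ i j, br (W i - Z j) ≠ 0) (c : ℂ),
      br c * (Matrix.of fun i j => br (c + (W i - Z j)) / br (W i - Z j)).det
        = br c ^ n * br (c + ∑ i, (W i - Z i))
          * (∏ i, ∏ j, if i < j then br (W j - W i) * br (Z i - Z j) else 1)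
          / ∏ i, ∏ j, br (W i - Z j) := by
  induction n with
  | zero => intro W Z _ c; simp
  | succ n ih =>
    intro W Z hne
    have hgen : ∀ c, br (c + (W 0 - Z 0)) ≠ 0 →
      br c * (Matrix.of fun i j => br (c + (W i - Z j)) / br (W i - Z j)).det
        = br c ^ (n + 1) * br (c + ∑ i, (W i - Z i))
          * (∏ i, ∏ j, if i < j then br (W j - W i) * br (Z i - Z j) else 1)
          / ∏ i, ∏ j, br (W i - Z j) := by
      intro c hc
      set M : Matrix (Fin (n + 1)) (Fin (n + 1)) ℂ :=
        Matrix.of fun i j => br (c + (W i - Z j)) / br (W i - Z j) with hM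
      have hM00 : M 0 0 ≠ 0 := div_ne_zero hc (hne 0 0)
      let q : Fin (n + 1) → ℂ := Fin.cons 0 fun i => M i.succ 0 / M 0 0
      let B : Matrix (Fin (n + 1)) (Fin (n + 1)) ℂ := Matrix.of fun i j => M i j - q i * M 0 j
      have hdet : M.det = B.det :=
        Matrix.det_eq_of_forall_row_eq_smul_add_const q 0 rfl fun i j => by
          simp [B, q]
      have hB0 : ∀ i : Fin n, B i.succ 0 = 0 := fun i => by simp [B, q, hM00]
      have hB : B.det = M 0 0 * (B.submatrix Fin.succ Fin.succ).det := by
        rw [Matrix.det_succ_column_zero, Fin.sum_univ_succ]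
        simp [hB0, B, q]
      have hsub : B.submatrix Fin.succ Fin.succ = Matrix.of fun i j =>
          (br c / br (c + (W 0 - Z 0)) * (br (W i.succ - W 0) / br (W i.succ - Z 0)))
          * Matrix.of (fun i j => (br (Z 0 - Z j.succ) / br (W 0 - Z j.succ))
          * Matrix.of (fun i j : Fin n => br (c + (W 0 - Z 0) + (W i.succ - Z j.succ))
              / br (W i.succ - Z j.succ)) i j) i j := by
        ext i j
        have h3 := three_term_det hW c (W i.succ) (Z j.succ) (W 0) (Z 0)
        have e1 := hne i.succ j.succ
        have e2 := hne i.succ 0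
        have e3 := hne 0 j.succ
        have e4 := hne 0 0
        simp only [Matrix.submatrix_apply, Matrix.of_apply, B, q, M, Fin.cons_succ]
        field_simp
        linear_combination h3
      have hIH := ih (fun i => W i.succ) (fun j => Z j.succ) (fun i j => hne _ _)
        (c + (W 0 - Z 0))
      rw [hdet, hB, hsub, Matrix.det_mul_column, Matrix.det_mul_row]
      simp only [Fin.prod_univ_succ, Fin.sum_univ_succ] at hIH ⊢
      simp only [Fin.succ_pos, Fin.succ_lt_succ_iff, if_true, lt_irrefl, if_false, Fin.not_lt_zero,
        prod_mul_distrib, prod_div_distrib, prod_const, card_univ, Fintype.card_fin, M,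
        Matrix.of_apply, one_mul] at hIH ⊢
      have p1 : ∏ i : Fin n, br (W i.succ - Z 0) ≠ 0 := prod_ne_zero_iff.2 fun i _ => hne _ _
      have p2 : ∏ i : Fin n, br (W 0 - Z i.succ) ≠ 0 := prod_ne_zero_iff.2 fun i _ => hne _ _
      have p3 : ∏ i : Fin n, ∏ j : Fin n, br (W i.succ - Z j.succ) ≠ 0 :=
        prod_ne_zero_iff.2 fun i _ => prod_ne_zero_iff.2 fun j _ => hne _ _
      have e4 := hne 0 0
      rw [← add_assoc]
      field_simp at hIH ⊢
      linear_combination br c ^ (n + 1) * (∏ i : Fin n, br (W i.succ - W 0))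
        * (∏ i : Fin n, br (Z 0 - Z i.succ)) * hIH
    have hdense : Dense {c : ℂ | br (c + (W 0 - Z 0)) ≠ 0} := fun c => by
      have h := eventually_ne_zero_of_entire
        (f := fun c => br (c + (W 0 - Z 0))) (by fun_prop)
        (fun h => hnz (funext fun z => by simpa using congrFun h (z - (W 0 - Z 0)))) c
      exact mem_closure_iff_frequently.2 (h.frequently.filter_mono nhdsWithin_le_nhds)
    have hc := hent.continuous
    refine congrFun (Continuous.ext_on hdense ?_ ?_ hgen)
    · refine hc.mul (Continuous.matrix_det (continuous_matrix fun i j => ?_))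
      simp only [Matrix.of_apply]
      fun_prop
    · fun_prop

/-- Contribution of the ordered pair `(i, j)` to the term of the subset `S` in the
elliptic subset-sum identity. -/
noncomputable def pairFactor (br : ℂ → ℂ) (t : ℂ) {ι : Type*} [DecidableEq ι] (X W : ι → ℂ)
    (S : Finset ι) (i j : ι) : ℂ :=
  (if i ∉ S ∧ j ∈ S then br (X j - X i - t) / br (X j - X i) else 1)
    * (if j ∈ S then br (W i - X j) else br (W i - X j + t))

/-- Multilinear expansion of the determinant of a difference of two matrices. -/
theorem sum_neg_one_pow_mul_det {n : ℕ} (a b : Fin n → Fin n → ℂ) :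
    ∑ S : Finset (Fin n), (-1 : ℂ) ^ S.card
        * (Matrix.of fun i j => if j ∈ S then b i j else a i j).det
      = (Matrix.of fun i j => a i j - b i j).det := by
  have h := (Matrix.detRowAlternating (n := Fin n) (R := ℂ)).toMultilinearMap.map_add_univ
    (fun j i => -b i j) (fun j i => a i j)
  have hL : (Matrix.of fun i j => a i j - b i j).det
      = Matrix.det ((fun j i => -b i j) + fun j i => a i j : Fin n → Fin n → ℂ) := by
    rw [← Matrix.det_transpose]
    congr 1
    ext j i
    simp [sub_eq_neg_add]
  rw [hL]
  refine Eq.trans (sum_congr rfl fun S _ => ?_) h.symm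
  rw [← Matrix.det_transpose]
  have hv : (-1 : ℂ) ^ S.card = ∏ j : Fin n, if j ∈ S then (-1 : ℂ) else 1 := by
    simp
  rw [hv, ← Matrix.det_mul_column]
  change _ = Matrix.det _
  congr 1
  ext j i
  by_cases hj : j ∈ S <;> simp [hj]

/-- The effect on a Vandermonde-type product of shifting some of the points. -/
theorem prod_lt_bracket_shift {br : ℂ → ℂ} (hodd : ∀ z : ℂ, br (-z) = -br z) {n : ℕ}
    (X X' : Fin n → ℂ) (c : ℂ) (S : Finset (Fin n))
    (hX' : ∀ i, X' i = X i + if i ∈ S then c else 0)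
    (hX : ∀ i j, i ≠ j → br (X i - X j) ≠ 0) :
    (∏ i, ∏ j, if i < j then br (X' i - X' j) else 1)
      = (∏ i, ∏ j, if i < j then br (X i - X j) else 1)
        * ∏ i, ∏ j, if i ∈ S ∧ j ∉ S then br (X i - X j + c) / br (X i - X j) else 1 := by
  rw [prod_prod_eq_prod_lt
    (fun i j => if i ∈ S ∧ j ∉ S then br (X i - X j + c) / br (X i - X j) else 1)
    (fun i => by simp)]
  simp only [← prod_mul_distrib]
  refine prod_congr rfl fun i _ => prod_congr rfl fun j _ => ?_
  by_cases hij : i < j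
  · have e := hX i j hij.ne
    simp only [if_pos hij, hX']
    by_cases hi : i ∈ S <;> by_cases hj : j ∈ S <;> simp only [hi, hj, not_true, not_false_eq_true,
      and_self, and_true, and_false, if_true, if_false, mul_one, one_mul, add_zero]
    · rw [add_sub_add_right_eq_sub]
    · rw [add_sub_right_comm]; field_simp
    · rw [show X j - X i + c = -(X i - (X j + c)) by ring, ← neg_sub (X i), hodd, hodd]
      field_simp
  · simp [hij]

/-- Frobenius determinants at partially shifted points, in terms of `pairFactor`. -/
theorem cauchy_quotient_eq_prod_pairFactor {br : ℂ → ℂ} (hodd : ∀ z : ℂ, br (-z) = -br z)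
    (t : ℂ) {n : ℕ} (X W : Fin n → ℂ)
    (hX : ∀ i j, i ≠ j → br (X i - X j) ≠ 0)
    (hW0 : ∀ i j, br (W i - X j) ≠ 0) (hWt : ∀ i j, br (W i - X j + t) ≠ 0)
    (S : Finset (Fin n)) (Z : Fin n → ℂ) (hZ : ∀ j, Z j = X j - if j ∈ S then t else 0) :
    (∏ i, ∏ j, if i < j then br (W j - W i) * br (Z i - Z j) else 1)
        / ∏ i, ∏ j, br (W i - Z j)
      = (∏ i, ∏ j, if i < j then br (W j - W i) * br (X i - X j) else 1)
        / (∏ i, ∏ j, br (W i - X j) * br (W i - X j + t))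
        * ∏ i, ∏ j, pairFactor br t X W S i j := by
  have hsplit : ∀ Y : Fin n → ℂ, (∏ i, ∏ j, if i < j then br (W j - W i) * br (Y i - Y j) else 1)
      = (∏ i, ∏ j, if i < j then br (W j - W i) else 1)
        * ∏ i, ∏ j, if i < j then br (Y i - Y j) else 1 := fun Y => by
    simp only [← prod_mul_distrib]
    refine prod_congr rfl fun i _ => prod_congr rfl fun j _ => ?_
    split_ifs <;> simp
  have hshift := prod_lt_bracket_shift hodd X Z (-t) S
    (fun j => by rw [hZ]; split_ifs <;> ring) hX
  rw [prod_comm (f := fun i j => if i ∈ S ∧ j ∉ S then _ else _)] at hshift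
  have hden : (∏ i, ∏ j, br (W i - Z j))⁻¹ = (∏ i, ∏ j, if j ∈ S then br (W i - X j)
        else br (W i - X j + t)) / ((∏ i, ∏ j, br (W i - X j)) * ∏ i, ∏ j, br (W i - X j + t)) := by
    simp only [← prod_mul_distrib, ← prod_div_distrib, ← prod_inv_distrib]
    refine prod_congr rfl fun i _ => prod_congr rfl fun j _ => ?_
    have h1 := hW0 i j
    have h2 := hWt i j
    rw [hZ]
    split_ifs
    · rw [← sub_add]; field_simp
    · rw [sub_zero]; field_simp
  rw [hsplit, hsplit, hshift, div_eq_mul_inv, hden]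
  simp only [pairFactor, prod_mul_distrib, and_comm (b := _ ∈ S), sub_eq_add_neg]
  ring

/-- The subset-sum identity for generic `W`. -/
theorem sum_pairFactor_eq_zero_of_generic {br : ℂ → ℂ} (hodd : ∀ z : ℂ, br (-z) = -br z)
    (hent : Differentiable ℂ br) (hnz : br ≠ 0)
    (hW : ∀ a b c d : ℂ,
      br (a + b) * br (a - b) * br (c + d) * br (c - d)
        + br (a + d) * br (a - d) * br (b + c) * br (b - c)
        = br (a + c) * br (a - c) * br (b + d) * br (b - d))
    (t : ℂ) {n : ℕ} (X W : Fin n → ℂ)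
    (hX : ∀ i j, i ≠ j → br (X i - X j) ≠ 0) (hWW : ∀ i j, i ≠ j → br (W i - W j) ≠ 0)
    (hW0 : ∀ i j, br (W i - X j) ≠ 0) (hWt : ∀ i j, br (W i - X j + t) ≠ 0) :
    ∑ S : Finset (Fin n), (-1 : ℂ) ^ S.card * br (S.card * t + ∑ i, (W i - X i))
      * ∏ i, ∏ j, pairFactor br t X W S i j = 0 := by
  have hbr := hent.continuous
  set C : ℂ := (∏ i, ∏ j, if i < j then br (W j - W i) * br (X i - X j) else 1)
    / (∏ i, ∏ j, br (W i - X j) * br (W i - X j + t)) with hC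
  have hC0 : C ≠ 0 := by
    refine div_ne_zero (prod_ne_zero_iff.2 fun i _ => prod_ne_zero_iff.2 fun j _ => ?_)
      (prod_ne_zero_iff.2 fun i _ => prod_ne_zero_iff.2 fun j _ => mul_ne_zero (hW0 i j) (hWt i j))
    split_ifs with h
    · exact mul_ne_zero (hWW j i h.ne') (hX i j h.ne)
    · exact one_ne_zero
  let g : ℂ → ℂ := fun c => ∑ S : Finset (Fin n), (-1 : ℂ) ^ S.card
    * br (c + (S.card * t + ∑ i, (W i - X i))) * ∏ i, ∏ j, pairFactor br t X W S i j
  let a : ℂ → Fin n → Fin n → ℂ := fun c i j => br (c + (W i - X j)) / br (W i - X j)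
  let b : ℂ → Fin n → Fin n → ℂ := fun c i j => br (c + (W i - X j + t)) / br (W i - X j + t)
  have hg : Continuous g := by fun_prop
  have hdet : ∀ c, br c * (Matrix.of fun i j => a c i j - b c i j).det = br c ^ n * C * g c := by
    intro c
    rw [← sum_neg_one_pow_mul_det, mul_sum, mul_sum]
    refine sum_congr rfl fun S _ => ?_
    let Z : Fin n → ℂ := fun j => X j - if j ∈ S then t else 0
    have hWZ : ∀ i j, W i - Z j = if j ∈ S then W i - X j + t else W i - X j := fun i j => by
      simp only [Z]; split_ifs <;> ring
    have hF := frobenius_det hent hnz hW n W Z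
      (fun i j => by rw [hWZ]; split_ifs <;> simp [hW0, hWt]) c
    rw [mul_div_assoc, cauchy_quotient_eq_prod_pairFactor hodd t X W hX hW0 hWt S Z fun _ => rfl]
      at hF
    have hM : (Matrix.of fun i j => br (c + (W i - Z j)) / br (W i - Z j))
        = Matrix.of fun i j => if j ∈ S then b c i j else a c i j := by
      ext i j
      simp only [Matrix.of_apply, hWZ, a, b]
      split_ifs <;> rfl
    have hsum : ∑ i, (W i - Z i) = S.card * t + ∑ i, (W i - X i) := by
      simp only [Z, sub_sub_eq_add_sub, add_sub_right_comm, sum_add_distrib]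
      simp [add_comm]
    rw [hM, hsum] at hF
    linear_combination (-1 : ℂ) ^ S.card * hF
  have hd := deriv_bracket_zero_ne_zero hent hnz hW
  have hb0 := bracket_zero hodd
  let q : ℂ → Matrix (Fin n) (Fin n) ℂ := fun c => Matrix.of fun i j => (a c i j - b c i j) / br c
  have hq : ∀ i j, ∃ l, Filter.Tendsto (fun c => q c i j) (nhdsWithin 0 {0}ᶜ) (nhds l) := by
    intro i j
    have hf : Differentiable ℂ fun c => a c i j - b c i j := by fun_prop
    have h1 := hasDerivAt_iff_tendsto_slope.1 (hf 0).hasDerivAt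
    have h2 := hasDerivAt_iff_tendsto_slope.1 (hent 0).hasDerivAt
    refine ⟨_, (h1.div h2 hd).congr' ?_⟩
    filter_upwards [self_mem_nhdsWithin] with c hc
    have hc0 : c ≠ 0 := hc
    have hz : a 0 i j - b 0 i j = 0 := by simp [a, b, hW0, hWt]
    simp only [Pi.div_apply, slope_def_field, hz, hb0, sub_zero, q, Matrix.of_apply]
    field_simp
  choose l hl using hq
  have hqdet : Filter.Tendsto (fun c => (q c).det) (nhdsWithin 0 {0}ᶜ)
      (nhds (Matrix.of l).det) :=
    ((Continuous.matrix_det continuous_id).tendsto (Matrix.of l)).comp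
      (tendsto_pi_nhds.2 fun i => tendsto_pi_nhds.2 fun j => hl i j)
  have hlim : Filter.Tendsto (fun c => br c * (q c).det) (nhdsWithin 0 {0}ᶜ) (nhds 0) := by
    have h := ((hbr.tendsto 0).mono_left nhdsWithin_le_nhds).mul hqdet
    rwa [hb0, zero_mul] at h
  have hgC : ∀ᶠ c in nhdsWithin (0 : ℂ) {0}ᶜ, br c * (q c).det = C * g c := by
    filter_upwards [eventually_ne_zero_of_entire hent hnz 0] with c hc
    have hs : (Matrix.of fun i j => a c i j - b c i j) = br c • q c := by
      ext i j; simp [q, mul_div_cancel₀ _ hc]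
    have h := hdet c
    rw [hs, Matrix.det_smul, Fintype.card_fin] at h
    apply mul_left_cancel₀ (pow_ne_zero n hc)
    linear_combination h
  have hg0 := tendsto_nhds_unique (hlim.congr' hgC)
    (((hg.tendsto 0).mono_left nhdsWithin_le_nhds).const_mul C)
  have := (mul_eq_zero.1 hg0.symm).resolve_left hC0
  simpa only [g, zero_add] using this

/-- The elliptic subset-sum identity. -/
theorem sum_pairFactor_fin_eq_zero {br : ℂ → ℂ} (hodd : ∀ z : ℂ, br (-z) = -br z)
    (hent : Differentiable ℂ br) (hnz : br ≠ 0)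
    (hW : ∀ a b c d : ℂ,
      br (a + b) * br (a - b) * br (c + d) * br (c - d)
        + br (a + d) * br (a - d) * br (b + c) * br (b - c)
        = br (a + c) * br (a - c) * br (b + d) * br (b - d))
    (t : ℂ) {n : ℕ} (X W : Fin n → ℂ) (hX : ∀ i j, i ≠ j → br (X i - X j) ≠ 0) :
    ∑ S : Finset (Fin n), (-1 : ℂ) ^ S.card * br (S.card * t + ∑ i, (W i - X i))
      * ∏ i, ∏ j, pairFactor br t X W S i j = 0 := by
  have hbr := hent.continuous
  let V : ℂ → Fin n → ℂ := fun s i => W i + s * ((i : ℕ) + 1 : ℂ)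
  have hcont : Continuous fun s => ∑ S : Finset (Fin n), (-1 : ℂ) ^ S.card
      * br (S.card * t + ∑ i, (V s i - X i)) * ∏ i, ∏ j, pairFactor br t X (V s) S i j := by
    unfold pairFactor
    refine continuous_finsetSum _ fun S _ => Continuous.mul (by fun_prop)
      (continuous_finsetProd _ fun i _ => continuous_finsetProd _ fun j _ => ?_)
    split_ifs <;> fun_prop
  have hev : ∀ᶠ s in nhdsWithin (0 : ℂ) {0}ᶜ, ∑ S : Finset (Fin n), (-1 : ℂ) ^ S.card
      * br (S.card * t + ∑ i, (V s i - X i)) * ∏ i, ∏ j, pairFactor br t X (V s) S i j = 0 := by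
    have h1 : ∀ i j : Fin n, ∀ᶠ s in nhdsWithin (0 : ℂ) {0}ᶜ, i ≠ j → br (V s i - V s j) ≠ 0 := by
      intro i j
      by_cases hij : i = j
      · simp [hij]
      · have hb : ((i : ℕ) : ℂ) - (j : ℕ) ≠ 0 := by
          rw [sub_ne_zero]; exact_mod_cast fun h => hij (Fin.ext h)
        filter_upwards [eventually_ne_zero_along_line hent hnz (W i - W j) hb] with s hs _
        rwa [show V s i - V s j = W i - W j + s * (((i : ℕ) : ℂ) - (j : ℕ)) by simp only [V]; ring]
    have h2 : ∀ (u : ℂ) (i j : Fin n), ∀ᶠ s in nhdsWithin (0 : ℂ) {0}ᶜ,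
        br (V s i - X j + u) ≠ 0 := by
      intro u i j
      filter_upwards [eventually_ne_zero_along_line hent hnz (W i - X j + u)
        (Nat.cast_add_one_ne_zero (i : ℕ))] with s hs
      rwa [show V s i - X j + u = W i - X j + u + s * ((i : ℕ) + 1 : ℂ) by simp only [V]; ring]
    filter_upwards [Filter.eventually_all.2 fun i => Filter.eventually_all.2 fun j => h1 i j,
      Filter.eventually_all.2 fun i => Filter.eventually_all.2 fun j => h2 0 i j,
      Filter.eventually_all.2 fun i => Filter.eventually_all.2 fun j => h2 t i j] with s hs1 hs2 hs3
    exact sum_pairFactor_eq_zero_of_generic hodd hent hnz hW t X (V s) hX hs1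
      (fun i j => by simpa using hs2 i j) hs3
  have h := tendsto_nhds_unique ((hcont.tendsto 0).mono_left nhdsWithin_le_nhds)
    (tendsto_const_nhds.congr' (hev.mono fun s hs => hs.symm))
  simpa [V] using h

/-- The elliptic subset-sum identity over the subsets of a finite set. -/
theorem sum_powerset_pairFactor_eq_zero {br : ℂ → ℂ} (hodd : ∀ z : ℂ, br (-z) = -br z)
    (hent : Differentiable ℂ br) (hnz : br ≠ 0)
    (hW : ∀ a b c d : ℂ,
      br (a + b) * br (a - b) * br (c + d) * br (c - d)
        + br (a + d) * br (a - d) * br (b + c) * br (b - c)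
        = br (a + c) * br (a - c) * br (b + d) * br (b - d))
    (t : ℂ) {ι : Type*} [DecidableEq ι] (A : Finset ι) (X W : ι → ℂ)
    (hX : ∀ i ∈ A, ∀ j ∈ A, i ≠ j → br (X i - X j) ≠ 0) :
    ∑ S ∈ A.powerset, (-1 : ℂ) ^ S.card * br (S.card * t + ∑ i ∈ A, (W i - X i))
      * ∏ i ∈ A, ∏ j ∈ A, pairFactor br t X W S i j = 0 := by
  obtain ⟨n, f, rfl⟩ : ∃ (n : ℕ) (f : Fin n ↪ ι), A = univ.map f := by
    refine ⟨_, A.equivFin.symm.toEmbedding.trans (Function.Embedding.subtype _), ?_⟩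
    ext i
    simp only [mem_map, mem_univ, true_and]
    exact ⟨fun h => ⟨A.equivFin ⟨i, h⟩, by simp⟩, by rintro ⟨k, rfl⟩; simp⟩
  have h := sum_pairFactor_fin_eq_zero hodd hent hnz hW t (X ∘ f) (W ∘ f) fun i j hij =>
    hX _ (mem_map_of_mem f (mem_univ i)) _ (mem_map_of_mem f (mem_univ j)) (f.injective.ne hij)
  rw [← h]
  symm
  refine sum_nbij (fun S => S.map f) (fun S _ => mem_powerset.2 (map_subset_map.2 (subset_univ S)))
    (map_injective f).injOn (fun S hS => ?_) fun S _ => ?_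
  · obtain ⟨S', -, rfl⟩ := subset_map_iff.1 (mem_powerset.1 hS)
    exact ⟨S', by simp, rfl⟩
  · simp [pairFactor]

/-- The elliptic subset-sum identity for two groups of variables, with the second subset
replaced by its complement. -/
theorem sum_sum_pairFactor_eq_zero {br : ℂ → ℂ} (hodd : ∀ z : ℂ, br (-z) = -br z)
    (hent : Differentiable ℂ br) (hnz : br ≠ 0)
    (hW : ∀ a b c d : ℂ,
      br (a + b) * br (a - b) * br (c + d) * br (c - d)
        + br (a + d) * br (a - d) * br (b + c) * br (b - c)
        = br (a + c) * br (a - c) * br (b + d) * br (b - d))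
    (t : ℂ) {m r : ℕ} (A : Finset (Fin m)) (B : Finset (Fin r)) (X W : Fin m ⊕ Fin r → ℂ)
    (hXX : ∀ i ∈ A, ∀ j ∈ A, i ≠ j → br (X (.inl i) - X (.inl j)) ≠ 0)
    (hXY : ∀ i ∈ A, ∀ j ∈ B, br (X (.inl i) - X (.inr j)) ≠ 0)
    (hYY : ∀ i ∈ B, ∀ j ∈ B, i ≠ j → br (X (.inr i) - X (.inr j)) ≠ 0) :
    ∑ p ∈ A.powerset ×ˢ B.powerset, (-1 : ℂ) ^ (p.1.card + p.2.card)
      * br (((p.1.card : ℂ) - p.2.card + B.card) * t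
          + (∑ i ∈ A, (W (.inl i) - X (.inl i)) + ∑ j ∈ B, (W (.inr j) - X (.inr j))))
      * ((∏ i ∈ A, ∏ j ∈ A, pairFactor br t X W (p.1.disjSum (B \ p.2)) (.inl i) (.inl j))
        * (∏ i ∈ A, ∏ j ∈ B, pairFactor br t X W (p.1.disjSum (B \ p.2)) (.inl i) (.inr j)
            * pairFactor br t X W (p.1.disjSum (B \ p.2)) (.inr j) (.inl i))
        * ∏ i ∈ B, ∏ j ∈ B, pairFactor br t X W (p.1.disjSum (B \ p.2)) (.inr i) (.inr j)) = 0 := by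
  have h := sum_powerset_pairFactor_eq_zero hodd hent hnz hW t (A.disjSum B) X W (by
    intro i hi j hj hij
    rcases i with i | i <;> rcases j with j | j <;>
      simp only [inl_mem_disjSum, inr_mem_disjSum] at hi hj
    · exact hXX i hi j hj fun h => hij (h ▸ rfl)
    · exact hXY i hi j hj
    · rw [← neg_sub, hodd]
      exact neg_ne_zero.2 (hXY j hj i hi)
    · exact hYY i hi j hj fun h => hij (h ▸ rfl))
  rw [← mul_zero ((-1 : ℂ) ^ B.card), ← h, mul_sum]
  refine sum_nbij' (fun p => p.1.disjSum (B \ p.2)) (fun S => (S.toLeft, B \ S.toRight))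
    ?_ ?_ ?_ ?_ ?_
  · rintro ⟨I, J⟩ hp
    simp only [mem_product, mem_powerset] at hp ⊢
    exact disjSum_mono hp.1 sdiff_subset
  · intro S hS
    simp only [mem_product, mem_powerset] at hS ⊢
    refine ⟨fun i hi => ?_, sdiff_subset⟩
    simpa using hS (mem_toLeft.1 hi)
  · rintro ⟨I, J⟩ hp
    simp only [mem_product, mem_powerset] at hp
    simp [inter_eq_right.2 hp.2]
  · intro S hS
    have hS' : S.toRight ⊆ B := fun j hj => by
      simpa using (mem_powerset.1 hS) (mem_toRight.1 hj)
    simp [inter_eq_right.2 hS', toLeft_disjSum_toRight]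
  · rintro ⟨I, J⟩ hp
    simp only [mem_product, mem_powerset] at hp
    have hcard : ((B \ J).card : ℂ) = B.card - J.card := by
      rw [card_sdiff_of_subset hp.2, Nat.cast_sub (card_le_card hp.2)]
    have hsign : (-1 : ℂ) ^ B.card * (-1) ^ (I.card + (B \ J).card) = (-1) ^ (I.card + J.card) := by
      rw [← card_sdiff_add_card_eq_card hp.2]
      ring_nf
      simp [mul_comm _ 2, pow_mul]
    simp only [card_disjSum, sum_disjSum, prod_disjSum, prod_mul_distrib, Nat.cast_add, hcard]
    rw [prod_comm (s := A) (t := B) (f := fun i j => pairFactor _ _ _ _ _ (Sum.inr j) (Sum.inl i)),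
      ← hsign, show ((I.card : ℂ) - J.card + B.card) = I.card + (B.card - J.card) by ring]
    ring

theorem sfac_natCast (br : ℂ → ℂ) (a x : ℂ) (n : ℕ) :
    sfac br a x n = ∏ i ∈ range n, br (x + (i : ℂ) * a) := by
  simp [sfac]

theorem sfac_natCast_succ (br : ℂ → ℂ) (a x : ℂ) (n : ℕ) :
    sfac br a x ((n + 1 : ℕ) : ℤ) = sfac br a x n * br (x + n * a) := by
  rw [sfac_natCast, sfac_natCast, prod_range_succ]

theorem sfac_natCast_succ_left (br : ℂ → ℂ) (a x : ℂ) (n : ℕ) :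
    sfac br a x ((n + 1 : ℕ) : ℤ) = br x * sfac br a (x + a) n := by
  rw [sfac_natCast, sfac_natCast, prod_range_succ', mul_comm]
  congr 1
  · simp
  · refine prod_congr rfl fun i _ => ?_
    push_cast
    ring_nf

theorem sfac_zero (br : ℂ → ℂ) (a x : ℂ) : sfac br a x 0 = 1 := by
  simp [sfac]

theorem prod_mul_prod_compl_eq_prod_ite {ι : Type*} [Fintype ι] [DecidableEq ι] (J : Finset ι)
    (f g : ι → ℂ) : (∏ j ∈ J, f j) * ∏ j ∈ Jᶜ, g j = ∏ j, if j ∈ J then f j else g j := by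
  rw [prod_ite]
  congr 1 <;> refine prod_congr ?_ fun _ _ => rfl <;> ext j <;> simp

theorem prod_prod_compl_eq_prod_ite {ι : Type*} [Fintype ι] [DecidableEq ι] (J : Finset ι)
    (f : ι → ι → ℂ) :
    ∏ i ∈ J, ∏ j ∈ Jᶜ, f i j = ∏ i, ∏ j, if i ∈ J ∧ j ∉ J then f i j else 1 := by
  have h : ∀ i, (∏ j, if i ∈ J ∧ j ∉ J then f i j else 1)
      = if i ∈ J then ∏ j ∈ Jᶜ, f i j else 1 := fun i => by
    by_cases hi : i ∈ J
    · simp only [hi, true_and, if_true]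
      rw [← prod_filter]
      exact prod_congr (by ext j; simp) fun _ _ => rfl
    · simp [hi]
  simp only [h]
  rw [prod_ite_mem, univ_inter]

/-- Separating the factors that involve only a sub-rectangle of a product over pairs. -/
theorem prod_prod_eq_mul_prod_prod {ι ι' : Type*} [Fintype ι] [Fintype ι'] [DecidableEq ι]
    [DecidableEq ι'] (A : Finset ι) (B : Finset ι') (F P G : ι → ι' → ℂ)
    (h : ∀ i j, F i j = P i j * if i ∈ A ∧ j ∈ B then G i j else 1) :
    ∏ i, ∏ j, F i j = (∏ i, ∏ j, P i j) * ∏ i ∈ A, ∏ j ∈ B, G i j := by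
  simp only [h, prod_mul_distrib]
  congr 1
  have h : ∀ i, (∏ j, if i ∈ A ∧ j ∈ B then G i j else 1)
      = if i ∈ A then ∏ j ∈ B, G i j else 1 := fun i => by
    by_cases hi : i ∈ A <;> simp [hi]
  simp only [h]
  rw [prod_ite_mem, univ_inter]

/-- The part of the composed coefficient that only involves the `x`-variables. -/
theorem coef_xx_part {br : ℂ → ℂ} (hodd : ∀ z : ℂ, br (-z) = -br z) (δ κ : ℂ) {m : ℕ}
    (x : Fin m → ℂ) (ν ρ : Fin m → ℕ) (I A : Finset (Fin m))
    (hρ : ∀ i, ν i = ρ i + if i ∈ I then 1 else 0) (hA : ∀ i, i ∈ A ↔ ν i ≠ 0)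
    (hx : ∀ i j, i ≠ j → br (x i - x j) ≠ 0)
    (hfac : ∀ i j, sfac br δ (x i - x j + δ) (ν i) ≠ 0) :
    (∏ i, ∏ j, if i < j then br (xshiftI δ I x i - xshiftI δ I x j + ((ρ i : ℂ) - ρ j) * δ)
          / br (xshiftI δ I x i - xshiftI δ I x j) else 1)
        * (∏ i ∈ I, ∏ j ∈ Iᶜ, br (x i - x j - -κ) / br (x i - x j))
        * (∏ i, ∏ j, sfac br δ (xshiftI δ I x i - xshiftI δ I x j + κ) (ρ i)
          / sfac br δ (xshiftI δ I x i - xshiftI δ I x j + δ) (ρ i))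
      = (∏ i, ∏ j, if i < j then br (x i - x j + ((ν i : ℂ) - ν j) * δ) / br (x i - x j) else 1)
        * (∏ i, ∏ j, if i ∈ A then (if j ∈ A then
              sfac br δ (x i - x j + κ) ((ν i - 1 : ℕ) : ℤ) / sfac br δ (x i - x j + δ) (ν i)
            else sfac br δ (x i - x j + κ) (ν i) / sfac br δ (x i - x j + δ) (ν i)) else 1)
        * ∏ i ∈ A, ∏ j ∈ A,
          (if i ∉ I ∧ j ∈ I then br (x j - x i - (κ - δ)) / br (x j - x i) else 1)
          * (if j ∈ I then br (x i + ν i * δ - x j) else br (x i + ν i * δ - x j + (κ - δ))) := by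
  have hshift := prod_lt_bracket_shift hodd x (xshiftI δ I x) δ I
    (fun i => by simp [xshiftI]) hx
  have hV : (∏ i, ∏ j, if i < j then br (xshiftI δ I x i - xshiftI δ I x j + ((ρ i : ℂ) - ρ j) * δ)
          / br (xshiftI δ I x i - xshiftI δ I x j) else 1)
      = (∏ i, ∏ j, if i < j then br (x i - x j + ((ν i : ℂ) - ν j) * δ) / br (x i - x j) else 1)
        * ∏ i, ∏ j, if i ∈ I ∧ j ∉ I then br (x i - x j) / br (x i - x j + δ) else 1 := by
    have hdiv : ∀ a b : Fin m → Fin m → ℂ, (∏ i, ∏ j, if i < j then a i j / b i j else 1)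
        = (∏ i, ∏ j, if i < j then a i j else 1) * (∏ i, ∏ j, if i < j then b i j else 1)⁻¹ :=
      fun a b => by
        simp only [← prod_mul_distrib, ← prod_inv_distrib]
        refine prod_congr rfl fun i _ => prod_congr rfl fun j _ => ?_
        split_ifs <;> simp [div_eq_mul_inv]
    rw [hdiv, hdiv, hshift, mul_inv, ← mul_assoc]
    congr 2
    · refine prod_congr rfl fun i _ => prod_congr rfl fun j _ => ?_
      congr 2
      rw [hρ i, hρ j]
      simp only [xshiftI]
      push_cast
      ring
    · simp only [← prod_inv_distrib]
      refine prod_congr rfl fun i _ => prod_congr rfl fun j _ => ?_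
      split_ifs <;> simp
  rw [hV, prod_prod_compl_eq_prod_ite, mul_assoc, mul_assoc, mul_assoc]
  congr 1
  simp only [← prod_mul_distrib]
  refine prod_prod_eq_mul_prod_prod A A _ _ _ fun i j => ?_
  have hAi : i ∈ I → i ∈ A := fun h => (hA i).2 (by simp [hρ, h])
  have hAj : j ∈ I → j ∈ A := fun h => (hA j).2 (by simp [hρ, h])
  have hf := hfac i j
  have hz : i ≠ j → br (x i - x j) ≠ 0 := hx i j
  have hρi := hρ i
  have hxi : xshiftI δ I x i - xshiftI δ I x j
      = x i - x j + δ * ((if i ∈ I then 1 else 0) - if j ∈ I then 1 else 0) := by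
    simp only [xshiftI]; ring
  rw [hxi]
  rw [show x j - x i - (κ - δ) = -(x i - x j + (κ - δ)) by ring, ← neg_sub (x i) (x j), hodd, hodd,
    neg_div_neg_eq, add_sub_right_comm]
  generalize x i - x j = z at *
  by_cases hi : i ∈ I
  · have hiA := hAi hi
    simp only [hi, if_true] at hρi
    rw [hρi, sfac_natCast_succ] at hf
    have hf2 := right_ne_zero_of_mul hf
    have hf1 := left_ne_zero_of_mul hf
    by_cases hj : j ∈ I
    · have hjA := hAj hj
      simp only [hi, hj, hiA, hjA, hρi, if_true, not_true, and_self, and_false, false_and, if_false,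
        sub_self, mul_zero, add_zero, one_mul, Nat.add_sub_cancel, sfac_natCast_succ]
      rw [show z + ((ρ i + 1 : ℕ) : ℂ) * δ = z + δ + ρ i * δ by push_cast; ring]
      generalize br (z + δ + ρ i * δ) = b at hf2 ⊢
      field_simp
    · have hz := hz (by rintro rfl; exact hj hi)
      simp only [hi, hj, hiA, hρi, if_true, not_true, not_false_eq_true, and_self,
        true_and, if_false, sub_zero, mul_one, one_mul, Nat.add_sub_cancel]
      have e : (br z / br (z + δ)) * (br (z - -κ) / br z * (sfac br δ (z + δ + κ) (ρ i)
          / sfac br δ (z + δ + δ) (ρ i)))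
          = sfac br δ (z + κ) ((ρ i + 1 : ℕ) : ℤ) / sfac br δ (z + δ) ((ρ i + 1 : ℕ) : ℤ) := by
        rw [sfac_natCast_succ_left, sfac_natCast_succ_left, sub_neg_eq_add, add_right_comm z δ κ]
        field_simp
      rw [e]
      by_cases hjA : j ∈ A
      · simp only [hjA, if_true]
        rw [sfac_natCast_succ _ _ (z + κ), show z + ((ρ i + 1 : ℕ) : ℂ) * δ + (κ - δ)
          = z + κ + ρ i * δ by push_cast; ring]
        ring
      · simp [hjA]
  · simp only [hi, if_false, add_zero] at hρi
    by_cases hiA : i ∈ A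
    · obtain ⟨k, hk⟩ := Nat.exists_eq_succ_of_ne_zero ((hA i).1 hiA)
      rw [Nat.succ_eq_add_one] at hk
      rw [hk, sfac_natCast_succ] at hf
      have hf2 := right_ne_zero_of_mul hf
      have hf1 := left_ne_zero_of_mul hf
      by_cases hj : j ∈ I
      · have hjA := hAj hj
        have hz := hz (by rintro rfl; exact hi hj)
        simp only [hi, hj, hiA, hjA, ← hρi, hk, if_true, not_true, not_false_eq_true, and_self,
          if_false, zero_sub, one_mul, Nat.add_sub_cancel, mul_neg, mul_one]
        rw [sfac_natCast_succ_left _ _ (z + -δ + κ), sfac_natCast_succ_left _ _ (z + -δ + δ),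
          sfac_natCast_succ, show z + -δ + κ + δ = z + κ by ring, show z + -δ + δ = z by ring,
          show z + ((k + 1 : ℕ) : ℂ) * δ = z + δ + k * δ by push_cast; ring,
          show z + -δ + κ = z + (κ - δ) by ring]
        generalize br (z + δ + k * δ) = b at hf2 ⊢
        field_simp
      · simp only [hi, hj, hiA, ← hρi, hk, if_true, not_false_eq_true,
          and_false, false_and, true_and, if_false, sub_self, mul_zero, add_zero, one_mul,
          Nat.add_sub_cancel]
        by_cases hjA : j ∈ A
        · simp only [hjA, if_true]
          rw [sfac_natCast_succ _ _ (z + κ), show z + ((k + 1 : ℕ) : ℂ) * δ + (κ - δ)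
            = z + κ + k * δ by push_cast; ring]
          ring
        · simp [hjA]
    · have h0 : ρ i = 0 := by rw [← hρi]; simpa using (hA i).not.1 hiA
      simp [hi, hiA, h0, sfac_zero]

/-- The part of the composed coefficient that only involves the `y`-variables. -/
theorem coef_yy_part {br : ℂ → ℂ} (hodd : ∀ z : ℂ, br (-z) = -br z) (δ κ : ℂ) {r : ℕ}
    (y : Fin r → ℂ) (l μ : Fin r → ℕ) (J B : Finset (Fin r))
    (hμ : ∀ j, l j = μ j + if j ∈ J then 1 else 0) (hB : ∀ j, j ∈ B ↔ l j ≠ 0)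
    (hy : ∀ i j, i ≠ j → ∀ a b : ℕ, a ≤ l i → b ≤ l j → br (y i - y j - ((a : ℂ) - b) * κ) ≠ 0)
    (hfac : ∀ i j, sfac br (-κ) (y i - y j + -κ) (l i) ≠ 0) :
    (∏ i, ∏ j, if i < j then br (y i - y j + ((μ i : ℂ) - μ j) * -κ) / br (y i - y j) else 1)
        * (∏ i ∈ J, ∏ j ∈ Jᶜ, br (yshiftMu κ μ y i - yshiftMu κ μ y j - δ)
          / br (yshiftMu κ μ y i - yshiftMu κ μ y j))
        * (∏ i, ∏ j, sfac br (-κ) (y i - y j + -δ) (μ i) / sfac br (-κ) (y i - y j + -κ) (μ i))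
      = (∏ i, ∏ j, if i < j then br (y i - y j + ((l i : ℂ) - l j) * -κ) / br (y i - y j) else 1)
        * (∏ i, ∏ j, if i ∈ B then (if j ∈ B then
              -(sfac br (-κ) (y i - y j + -δ) ((l i - 1 : ℕ) : ℤ)
                / sfac br (-κ) (y i - y j + -κ) (l i))
            else sfac br (-κ) (y i - y j + -δ) (l i) / sfac br (-κ) (y i - y j + -κ) (l i)) else 1)
        * ∏ i ∈ B, ∏ j ∈ B,
          (if i ∈ J ∧ j ∉ J then
            br (y j - l j * κ + κ - (y i - l i * κ + κ) - (κ - δ))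
              / br (y j - l j * κ + κ - (y i - l i * κ + κ)) else 1)
          * (if j ∈ J then br (y i + δ - (y j - l j * κ + κ) + (κ - δ))
            else br (y i + δ - (y j - l j * κ + κ))) := by
  have hy' : ∀ i j, i ≠ j → br ((y i - l i * κ) - (y j - l j * κ)) ≠ 0 := fun i j hij => by
    convert hy i j hij _ _ le_rfl le_rfl using 2; ring
  have hμJ : ∀ i, (μ i : ℂ) = l i - if i ∈ J then 1 else 0 := fun i => by
    rw [hμ i]; push_cast; ring
  have hshift := prod_lt_bracket_shift hodd (fun i => y i - l i * κ) (yshiftMu κ μ y) κ J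
    (fun i => by simp only [yshiftMu, hμJ]; split_ifs <;> ring) hy'
  have hV : (∏ i, ∏ j, if i < j then br (y i - y j + ((μ i : ℂ) - μ j) * -κ) / br (y i - y j) else 1)
      = (∏ i, ∏ j, if i < j then br (y i - y j + ((l i : ℂ) - l j) * -κ) / br (y i - y j) else 1)
        * ∏ i, ∏ j, if i ∈ J ∧ j ∉ J then br ((y i - l i * κ) - (y j - l j * κ) + κ)
          / br ((y i - l i * κ) - (y j - l j * κ)) else 1 := by
    have hdiv : ∀ a b : Fin r → Fin r → ℂ, (∏ i, ∏ j, if i < j then a i j / b i j else 1)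
        = (∏ i, ∏ j, if i < j then a i j else 1) * (∏ i, ∏ j, if i < j then b i j else 1)⁻¹ :=
      fun a b => by
        simp only [← prod_mul_distrib, ← prod_inv_distrib]
        refine prod_congr rfl fun i _ => prod_congr rfl fun j _ => ?_
        split_ifs <;> simp [div_eq_mul_inv]
    have e1 : ∀ i j, y i - y j + ((μ i : ℂ) - μ j) * -κ = yshiftMu κ μ y i - yshiftMu κ μ y j :=
      fun i j => by simp only [yshiftMu]; ring
    have e2 : ∀ i j, y i - y j + ((l i : ℂ) - l j) * -κ = (y i - l i * κ) - (y j - l j * κ) :=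
      fun i j => by ring
    simp only [e1, e2]
    rw [hdiv, hdiv, hshift]
    ring
  rw [hV, prod_prod_compl_eq_prod_ite, mul_assoc, mul_assoc, mul_assoc]
  congr 1
  have hswap : (∏ i ∈ B, ∏ j ∈ B,
          (if i ∈ J ∧ j ∉ J then
            br (y j - l j * κ + κ - (y i - l i * κ + κ) - (κ - δ))
              / br (y j - l j * κ + κ - (y i - l i * κ + κ)) else 1)
          * (if j ∈ J then br (y i + δ - (y j - l j * κ + κ) + (κ - δ))
            else br (y i + δ - (y j - l j * κ + κ))))
      = ∏ i ∈ B, ∏ j ∈ B,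
          (if i ∈ J ∧ j ∉ J then
            br (y j - l j * κ + κ - (y i - l i * κ + κ) - (κ - δ))
              / br (y j - l j * κ + κ - (y i - l i * κ + κ)) else 1)
          * (if i ∈ J then br (y j + δ - (y i - l i * κ + κ) + (κ - δ))
            else br (y j + δ - (y i - l i * κ + κ))) := by
    simp only [prod_mul_distrib]
    congr 1
    exact prod_comm
  rw [hswap]
  simp only [← prod_mul_distrib]
  refine prod_prod_eq_mul_prod_prod B B _ _ _ fun i j => ?_
  have hBi : i ∈ J → i ∈ B := fun h => (hB i).2 (by simp [hμ, h])
  have hf := hfac i j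
  have hμi := hμ i
  rw [show y j - l j * κ + κ - (y i - l i * κ + κ) - (κ - δ)
      = -(y i - l i * κ - (y j - l j * κ) + κ - δ) by ring,
    show y j - l j * κ + κ - (y i - l i * κ + κ) = -(y i - l i * κ - (y j - l j * κ)) by ring,
    hodd, hodd, neg_div_neg_eq,
    show y j + δ - (y i - l i * κ + κ) + (κ - δ) = -(y i - y j + -κ + ((l i : ℂ) - 1) * -κ) by ring,
    show y j + δ - (y i - l i * κ + κ) = -(y i - y j + -δ + ((l i : ℂ) - 1) * -κ) by ring,
    hodd, hodd]
  by_cases hi : i ∈ J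
  · have hiB := hBi hi
    simp only [hi, if_true] at hμi
    rw [hμi, sfac_natCast_succ] at hf
    have hf2 := right_ne_zero_of_mul hf
    have hf1 := left_ne_zero_of_mul hf
    have hc : ((μ i + 1 : ℕ) : ℂ) - 1 = μ i := by push_cast; ring
    by_cases hj : j ∈ J
    · have hjB : j ∈ B := (hB j).2 (by simp [hμ, hj])
      simp only [hi, hj, hiB, hjB, hμi, if_true, not_true, and_self, and_false, if_false,
        one_mul, Nat.add_sub_cancel, sfac_natCast_succ, hc]
      generalize br (y i - y j + -κ + μ i * -κ) = b at hf2 ⊢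
      field_simp
    · have hij : i ≠ j := by rintro rfl; exact hj hi
      have hY := hy' i j hij
      have hYκ : br (y i - l i * κ - (y j - l j * κ) + κ) ≠ 0 := by
        convert hy i j hij (μ i) (l j) (by omega) le_rfl using 2
        rw [hμi]; push_cast; ring
      have hmj : (μ j : ℂ) = l j := by rw [hμ j]; simp [hj]
      have e : yshiftMu κ μ y i - yshiftMu κ μ y j = y i - l i * κ - (y j - l j * κ) + κ := by
        simp only [yshiftMu, hmj, hμi]; push_cast; ring
      rw [e]
      by_cases hjB : j ∈ B
      · simp only [hi, hj, hiB, hjB, if_true, not_false_eq_true, and_self]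
        simp only [hμi, Nat.add_sub_cancel, sfac_natCast_succ, hc] at hY hYκ ⊢
        generalize br (y i - y j + -κ + μ i * -κ) = b at hf2 ⊢
        generalize br (y i - (μ i + 1 : ℕ) * κ - (y j - l j * κ)) = c at hY ⊢
        generalize br (y i - (μ i + 1 : ℕ) * κ - (y j - l j * κ) + κ) = d at hYκ ⊢
        field_simp
      · have hlj : (l j : ℂ) = 0 := by simpa using (hB j).not.1 hjB
        simp only [hi, hj, hiB, hjB, if_true, not_false_eq_true, and_self, and_false, if_false,
          mul_one]
        rw [hlj] at hY hYκ ⊢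
        have e1 : y i - l i * κ - (y j - 0 * κ) = y i - y j + -κ + μ i * -κ := by
          rw [hμi]; push_cast; ring
        have e2 : y i - l i * κ - (y j - 0 * κ) + κ - δ = y i - y j + -δ + μ i * -κ := by
          rw [hμi]; push_cast; ring
        rw [e2, e1, hμi, sfac_natCast_succ, sfac_natCast_succ]
        rw [e1] at hYκ
        generalize br (y i - y j + -κ + μ i * -κ) = b at hf2 ⊢
        generalize br (y i - y j + -κ + μ i * -κ + κ) = d at hYκ ⊢
        field_simp
  · simp only [hi, if_false, add_zero] at hμi
    by_cases hiB : i ∈ B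
    · obtain ⟨k, hk⟩ := Nat.exists_eq_succ_of_ne_zero ((hB i).1 hiB)
      rw [Nat.succ_eq_add_one] at hk
      have hc : ((k + 1 : ℕ) : ℂ) - 1 = k := by push_cast; ring
      simp only [hi, hiB, ← hμi, hk, false_and, if_true, if_false, true_and, one_mul,
        Nat.add_sub_cancel, hc]
      by_cases hjB : j ∈ B
      · simp only [hjB, if_true, sfac_natCast_succ]
        ring
      · simp [hjB]
    · have h0 : μ i = 0 := by rw [← hμi]; simpa using (hB i).not.1 hiB
      simp [hi, hiB, h0, sfac_zero]

/-- The part of the composed coefficient that involves one `x`- and one `y`-variable. -/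
theorem coef_xy_part {br : ℂ → ℂ} (hodd : ∀ z : ℂ, br (-z) = -br z) (δ κ : ℂ) {m r : ℕ}
    (x : Fin m → ℂ) (y : Fin r → ℂ) (ν ρ : Fin m → ℕ) (l μ : Fin r → ℕ)
    (I A : Finset (Fin m)) (J B : Finset (Fin r))
    (hρ : ∀ i, ν i = ρ i + if i ∈ I then 1 else 0) (hA : ∀ i, i ∈ A ↔ ν i ≠ 0)
    (hμ : ∀ j, l j = μ j + if j ∈ J then 1 else 0) (hB : ∀ j, j ∈ B ↔ l j ≠ 0)
    (h₁ : ∀ i ∈ A, ∀ j, br (x i - y j + l j * κ) ≠ 0)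
    (h₂ : ∀ i, ∀ j ∈ B, br (x i - y j + l j * κ - 2 * κ) ≠ 0)
    (h₃ : ∀ i j, br (x i - y j + l j * κ - κ) ≠ 0)
    (h₄ : ∀ i j, br (x i - y j + l j * κ + ν i * δ - δ) ≠ 0)
    (h₅ : ∀ i, ∀ j ∈ B, br (x i - y j + l j * κ + ν i * δ - κ) ≠ 0) :
    (∏ j, ((∏ i ∈ I, br (y j - x i - -δ) / br (y j - x i + μ j * -κ))
          * ∏ i ∈ Iᶜ, br (y j - x i - -κ) / br (y j - x i + ((μ j : ℂ) - 1) * -κ)))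
        * (∏ i, ((∏ j ∈ J, br (xshiftI δ I x i - yshiftMu κ μ y j - κ)
            / br (xshiftI δ I x i - yshiftMu κ μ y j + ρ i * δ))
          * ∏ j ∈ Jᶜ, br (xshiftI δ I x i - yshiftMu κ μ y j - δ)
            / br (xshiftI δ I x i - yshiftMu κ μ y j + ((ρ i : ℂ) - 1) * δ)))
      = (∏ i, ∏ j, if i ∈ A then (if j ∈ B then
            -(br (x i - y j + l j * κ + ν i * δ - δ) * br (x i - y j + l j * κ + ν i * δ - κ))⁻¹
          else br (x i - y j - δ) / br (x i - y j + ν i * δ - δ))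
          else br (x i - y j - κ) / br (x i - y j + l j * κ - κ))
        * ∏ i ∈ A, ∏ j ∈ B,
          ((if i ∉ I ∧ j ∉ J then br (y j - l j * κ + κ - x i - (κ - δ))
              / br (y j - l j * κ + κ - x i) else 1)
            * (if j ∈ J then br (x i + ν i * δ - (y j - l j * κ + κ) + (κ - δ))
              else br (x i + ν i * δ - (y j - l j * κ + κ))))
          * ((if j ∈ J ∧ i ∈ I then br (x i - (y j - l j * κ + κ) - (κ - δ))
              / br (x i - (y j - l j * κ + κ)) else 1)
            * (if i ∈ I then br (y j + δ - x i) else br (y j + δ - x i + (κ - δ)))) := by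
  simp only [prod_mul_prod_compl_eq_prod_ite]
  rw [prod_comm]
  simp only [← prod_mul_distrib]
  refine prod_prod_eq_mul_prod_prod A B _ _ _ fun i j => ?_
  have hAi : i ∈ I → i ∈ A := fun h => (hA i).2 (by simp [hρ, h])
  have hBj : j ∈ J → j ∈ B := fun h => (hB j).2 (by simp [hμ, h])
  have hρi : (ρ i : ℂ) = ν i - if i ∈ I then 1 else 0 := by rw [hρ i]; push_cast; ring
  have hμj : (μ j : ℂ) = l j - if j ∈ J then 1 else 0 := by rw [hμ j]; push_cast; ring
  have hν : i ∉ A → (ν i : ℂ) = 0 := fun h => by simpa using (hA i).not.1 h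
  have hl : j ∉ B → (l j : ℂ) = 0 := fun h => by simpa using (hB j).not.1 h
  replace h₁ := fun h => h₁ i h j
  replace h₂ := h₂ i j
  replace h₃ := h₃ i j
  replace h₄ := h₄ i j
  replace h₅ := h₅ i j
  simp only [xshiftI, yshiftMu, hρi, hμj]
  obtain ⟨u, hu⟩ : ∃ u, x i - y j = u := ⟨_, rfl⟩
  have hx : x i = y j + u := by rw [← hu]; ring
  rw [hx]
  simp only [hx, add_sub_cancel_left] at h₁ h₂ h₃ h₄ h₅
  rw [add_sub_cancel_left,
    show y j - (y j + u) - -δ = -(u - δ) by ring, show y j - (y j + u) - -κ = -(u - κ) by ring,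
    show y j - l j * κ + κ - (y j + u) - (κ - δ) = -(u + l j * κ - δ) by ring,
    show y j - l j * κ + κ - (y j + u) = -(u + l j * κ - κ) by ring,
    show y j + u + ν i * δ - (y j - l j * κ + κ) + (κ - δ) = u + l j * κ + ν i * δ - δ by ring,
    show y j + u + ν i * δ - (y j - l j * κ + κ) = u + l j * κ + ν i * δ - κ by ring,
    show y j + u - (y j - l j * κ + κ) - (κ - δ) = u + l j * κ - 2 * κ + δ by ring,
    show y j + u - (y j - l j * κ + κ) = u + l j * κ - κ by ring,
    show y j + δ - (y j + u) + (κ - δ) = -(u - κ) by ring,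
    show y j + δ - (y j + u) = -(u - δ) by ring]
  have d₁ : ∀ c : ℂ, y j - (y j + u) + (l j - c) * -κ = -(u + l j * κ - c * κ) := fun c => by ring
  have d₂ : ∀ c : ℂ, y j - (y j + u) + (l j - c - 1) * -κ = -(u + l j * κ - κ - c * κ) :=
    fun c => by ring
  have d₃ : ∀ c d : ℂ, y j + u + δ * d - (y j - κ * (l j - c)) - κ
      = u + l j * κ - κ + d * δ - c * κ := fun c d => by ring
  have d₄ : ∀ c d : ℂ, y j + u + δ * d - (y j - κ * (l j - c)) + (ν i - d) * δ
      = u + l j * κ + ν i * δ - c * κ := fun c d => by ring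
  have d₅ : ∀ c d : ℂ, y j + u + δ * d - (y j - κ * (l j - c)) - δ
      = u + l j * κ - δ + d * δ - c * κ := fun c d => by ring
  have d₆ : ∀ c d : ℂ, y j + u + δ * d - (y j - κ * (l j - c)) + (ν i - d - 1) * δ
      = u + l j * κ + ν i * δ - δ - c * κ := fun c d => by ring
  simp only [d₁, d₂, d₃, d₄, d₅, d₆, hodd, neg_div_neg_eq]
  have c₁ : u + l j * κ - δ + δ = u + l j * κ := by ring
  have c₂ : u + l j * κ - κ - κ = u + l j * κ - 2 * κ := by ring
  have c₃ : u + l j * κ - κ + δ - κ = u + l j * κ - 2 * κ + δ := by ring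
  have c₄ : i ∉ A → u + l j * κ + ν i * δ - δ = u + l j * κ - δ := fun h => by
    rw [hν h]; ring
  have c₅ : i ∉ A → u + l j * κ + ν i * δ - κ = u + l j * κ - κ := fun h => by
    rw [hν h]; ring
  have c₆ : j ∉ B → u + l j * κ = u := fun h => by rw [hl h]; ring
  have c₇ : j ∉ B → u + ν i * δ = u + l j * κ + ν i * δ := fun h => by rw [hl h]; ring
  clear d₁ d₂ d₃ d₄ d₅ d₆
  generalize u + l j * κ = v at *
  generalize v + ν i * δ = w at *
  generalize v - 2 * κ = v' at *
  by_cases hi : i ∈ I <;> by_cases hj : j ∈ J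
  · have := h₅ (hBj hj)
    simp only [hi, hj, hAi hi, hBj hj, if_true, not_true, and_self, if_false, one_mul, c₃]
    field_simp
  · have := h₁ (hAi hi)
    by_cases hjB : j ∈ B
    · have := h₅ hjB
      simp only [hi, hj, hAi hi, hjB, if_true, not_true, false_and, and_self, if_false, one_mul,
        zero_mul, sub_zero, c₁]
      field_simp
    · simp only [hi, hj, hAi hi, hjB, if_true, and_false, if_false, one_mul,
        zero_mul, sub_zero, c₁]
      rw [c₇ hjB]
      field_simp
  · have := h₂ (hBj hj)
    have := h₅ (hBj hj)
    by_cases hiA : i ∈ A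
    · simp only [hi, hj, hiA, hBj hj, if_true, not_true, and_false, and_self, if_false, one_mul,
        zero_mul, add_zero, c₂]
      field_simp
    · simp only [hi, hj, hiA, if_true, false_and, if_false, one_mul, zero_mul, add_zero, c₂, c₅ hiA]
      field_simp
  · by_cases hiA : i ∈ A
    · by_cases hjB : j ∈ B
      · have := h₅ hjB
        simp only [hi, hj, hiA, hjB, if_true, not_false_eq_true, and_self, if_false,
          zero_mul, add_zero, sub_zero]
        field_simp
      · simp only [hi, hj, hiA, hjB, if_true, and_false, if_false, zero_mul, add_zero, sub_zero]
        rw [c₇ hjB, ← c₆ hjB]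
        field_simp
    · rw [c₄ hiA] at h₄ ⊢
      simp only [hi, hj, hiA, false_and, if_false, zero_mul, add_zero, sub_zero]
      field_simp

/-- Up to a factor that only depends on the total shift `(ν, l)`, the product of the coefficients of
the two operators is a product of pair factors. -/
theorem exists_coef_mul_coef_eq {br : ℂ → ℂ} (hodd : ∀ z : ℂ, br (-z) = -br z) (δ κ : ℂ)
    {m r : ℕ} (x : Fin m → ℂ) (y : Fin r → ℂ) (ν : Fin m → ℕ) (l : Fin r → ℕ)
    (A : Finset (Fin m)) (B : Finset (Fin r)) (hA : ∀ i, i ∈ A ↔ ν i ≠ 0)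
    (hB : ∀ j, j ∈ B ↔ l j ≠ 0)
    (hx : ∀ i j, i ≠ j → br (x i - x j) ≠ 0)
    (hxfac : ∀ i j, sfac br δ (x i - x j + δ) (ν i) ≠ 0)
    (hy : ∀ i j, i ≠ j → ∀ a b : ℕ, a ≤ l i → b ≤ l j → br (y i - y j - ((a : ℂ) - b) * κ) ≠ 0)
    (hyfac : ∀ i j, sfac br (-κ) (y i - y j + -κ) (l i) ≠ 0)
    (h₁ : ∀ i ∈ A, ∀ j, br (x i - y j + l j * κ) ≠ 0)
    (h₂ : ∀ i, ∀ j ∈ B, br (x i - y j + l j * κ - 2 * κ) ≠ 0)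
    (h₃ : ∀ i j, br (x i - y j + l j * κ - κ) ≠ 0)
    (h₄ : ∀ i j, br (x i - y j + l j * κ + ν i * δ - δ) ≠ 0)
    (h₅ : ∀ i, ∀ j ∈ B, br (x i - y j + l j * κ + ν i * δ - κ) ≠ 0)
    {X W : Fin m ⊕ Fin r → ℂ} (hX : X = Sum.elim x fun j => y j - l j * κ + κ)
    (hW : W = Sum.elim (fun i => x i + ν i * δ) fun j => y j + δ) :
    ∃ P : ℂ, ∀ (I : Finset (Fin m)) (J : Finset (Fin r)) (ρ : Fin m → ℕ) (μ : Fin r → ℕ),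
      (∀ i, ν i = ρ i + if i ∈ I then 1 else 0) → (∀ j, l j = μ j + if j ∈ J then 1 else 0) →
      Coef br (-κ) (-δ) μ I y x * Coef br δ κ ρ J (xshiftI δ I x) (yshiftMu κ μ y)
        = P * ((-1 : ℂ) ^ (I.card + J.card)
          * ((∏ i ∈ A, ∏ j ∈ A, pairFactor br (κ - δ) X W (I.disjSum (B \ J)) (.inl i) (.inl j))
            * (∏ i ∈ A, ∏ j ∈ B, pairFactor br (κ - δ) X W (I.disjSum (B \ J)) (.inl i) (.inr j)
                * pairFactor br (κ - δ) X W (I.disjSum (B \ J)) (.inr j) (.inl i))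
            * ∏ i ∈ B, ∏ j ∈ B,
                pairFactor br (κ - δ) X W (I.disjSum (B \ J)) (.inr i) (.inr j))) := by
  constructor
  · intro I J ρ μ hρ hμ
    have hxx := coef_xx_part hodd δ κ x ν ρ I A hρ hA hx hxfac
    have hyy := coef_yy_part hodd δ κ y l μ J B hμ hB hy hyfac
    have hxy := coef_xy_part hodd δ κ x y ν ρ l μ I A J B hρ hA hμ hB h₁ h₂ h₃ h₄ h₅
    have pxx : (∏ i ∈ A, ∏ j ∈ A, pairFactor br (κ - δ) X W (I.disjSum (B \ J)) (.inl i) (.inl j))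
        = ∏ i ∈ A, ∏ j ∈ A,
          (if i ∉ I ∧ j ∈ I then br (x j - x i - (κ - δ)) / br (x j - x i) else 1)
          * (if j ∈ I then br (x i + ν i * δ - x j) else br (x i + ν i * δ - x j + (κ - δ))) := by
      simp only [pairFactor, hX, hW, inl_mem_disjSum, Sum.elim_inl]
    have pyy : (∏ i ∈ B, ∏ j ∈ B, pairFactor br (κ - δ) X W (I.disjSum (B \ J)) (.inr i) (.inr j))
        = ∏ i ∈ B, ∏ j ∈ B,
          (if i ∈ J ∧ j ∉ J then
            br (y j - l j * κ + κ - (y i - l i * κ + κ) - (κ - δ))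
              / br (y j - l j * κ + κ - (y i - l i * κ + κ)) else 1)
          * (if j ∈ J then br (y i + δ - (y j - l j * κ + κ) + (κ - δ))
            else br (y i + δ - (y j - l j * κ + κ))) := by
      refine prod_congr rfl fun i hi => prod_congr rfl fun j hj => ?_
      simp only [pairFactor, hX, hW, inr_mem_disjSum, Sum.elim_inr, mem_sdiff, hi, hj, true_and,
        not_not, ite_not]
    have pxy : (∏ i ∈ A, ∏ j ∈ B, pairFactor br (κ - δ) X W (I.disjSum (B \ J)) (.inl i) (.inr j)
          * pairFactor br (κ - δ) X W (I.disjSum (B \ J)) (.inr j) (.inl i))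
        = ∏ i ∈ A, ∏ j ∈ B,
          ((if i ∉ I ∧ j ∉ J then br (y j - l j * κ + κ - x i - (κ - δ))
              / br (y j - l j * κ + κ - x i) else 1)
            * (if j ∈ J then br (x i + ν i * δ - (y j - l j * κ + κ) + (κ - δ))
              else br (x i + ν i * δ - (y j - l j * κ + κ))))
          * ((if j ∈ J ∧ i ∈ I then br (x i - (y j - l j * κ + κ) - (κ - δ))
              / br (x i - (y j - l j * κ + κ)) else 1)
            * (if i ∈ I then br (y j + δ - x i) else br (y j + δ - x i + (κ - δ)))) := by
      refine prod_congr rfl fun i hi => prod_congr rfl fun j hj => ?_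
      simp only [pairFactor, hX, hW, inl_mem_disjSum, inr_mem_disjSum, Sum.elim_inl, Sum.elim_inr,
        mem_sdiff, hj, true_and, not_not, ite_not]
    rw [← pxx] at hxx
    rw [← pyy] at hyy
    rw [← pxy] at hxy
    have hsplit : ∀ s a b c d s' a' b' c' d' : ℂ, (s * a * b * c * d) * (s' * a' * b' * c' * d')
        = s * s' * ((a' * b * c') * (a * b' * c) * (d * d')) := fun _ _ _ _ _ _ _ _ _ _ => by ring
    rw [Coef, Coef, hsplit, ← pow_add, hxx, hyy, hxy]
    have hcomb : ∀ s V U p V' U' p' Q p'' : ℂ, s * ((V * U * p) * (V' * U' * p') * (Q * p''))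
        = V * U * (V' * U') * Q * (s * (p * p'' * p')) := fun _ _ _ _ _ _ _ _ _ => by ring
    exact hcomb _ _ _ _ _ _ _ _ _

theorem mem_idxSet {m r k : ℕ} {p : (Fin m → ℕ) × Finset (Fin r)} :
    p ∈ idxSet m r k ↔ (∑ i, p.1 i) + p.2.card = k := by
  simp only [idxSet, mem_filter, mem_product, Fintype.mem_piFinset, mem_range, mem_univ, and_true,
    and_iff_right_iff_imp]
  intro h i
  have := single_le_sum (f := p.1) (fun _ _ => Nat.zero_le _) (mem_univ i)
  omega

theorem sum_sub_indicator {ι : Type*} [Fintype ι] [DecidableEq ι] (ν : ι → ℕ) (I : Finset ι)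
    (h : ∀ i ∈ I, ν i ≠ 0) : (∑ i, (ν i - if i ∈ I then 1 else 0)) + I.card = ∑ i, ν i := by
  have : I.card = ∑ i, if i ∈ I then 1 else 0 := by simp
  rw [this, ← sum_add_distrib]
  refine sum_congr rfl fun i _ => Nat.sub_add_cancel ?_
  split_ifs with hi
  · exact Nat.one_le_iff_ne_zero.2 (h i hi)
  · exact Nat.zero_le _

/-- The contributions to the Wronski relation with a fixed total shift `(ν, l)` cancel. -/
theorem sum_coef_mul_coef_eq_zero {br : ℂ → ℂ} (hodd : ∀ z : ℂ, br (-z) = -br z)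
    (hent : Differentiable ℂ br) (hnz : br ≠ 0)
    (hW : ∀ a b c d : ℂ,
      br (a + b) * br (a - b) * br (c + d) * br (c - d)
        + br (a + d) * br (a - d) * br (b + c) * br (b - c)
        = br (a + c) * br (a - c) * br (b + d) * br (b - d))
    (δ κ : ℂ) {m r : ℕ} (x : Fin m → ℂ) (y : Fin r → ℂ) (ν : Fin m → ℕ) (l : Fin r → ℕ)
    (hD : ∀ p : (Fin r → ℕ) × Finset (Fin m), (∑ j, p.1 j) + p.2.card ≤ (∑ i, ν i) + ∑ j, l j →
      CDenomNZ br (-κ) p.1 p.2 y x)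
    (hH : ∀ (p : (Fin r → ℕ) × Finset (Fin m)) (q : (Fin m → ℕ) × Finset (Fin r)),
      (∑ j, p.1 j) + p.2.card + ((∑ i, q.1 i) + q.2.card) = (∑ i, ν i) + ∑ j, l j →
      CDenomNZ br δ q.1 q.2 (xshiftI δ p.2 x) (yshiftMu κ p.1 y)) :
    ∑ p ∈ (univ.filter fun i => ν i ≠ 0).powerset ×ˢ (univ.filter fun j => l j ≠ 0).powerset,
      br (((p.1.card : ℂ) - p.2.card + ∑ j, (l j : ℂ)) * κ
          + ((p.2.card : ℂ) - p.1.card + ∑ i, (ν i : ℂ)) * δ)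
        * (Coef br (-κ) (-δ) (fun j => l j - if j ∈ p.2 then 1 else 0) p.1 y x
          * Coef br δ κ (fun i => ν i - if i ∈ p.1 then 1 else 0) p.2 (xshiftI δ p.1 x)
            (yshiftMu κ (fun j => l j - if j ∈ p.2 then 1 else 0) y)) = 0 := by
  have hA : ∀ i, i ∈ (univ.filter fun i => ν i ≠ 0) ↔ ν i ≠ 0 := by simp
  have hB : ∀ j, j ∈ (univ.filter fun j => l j ≠ 0) ↔ l j ≠ 0 := by simp
  generalize (univ.filter fun i => ν i ≠ 0) = A at *
  generalize (univ.filter fun j => l j ≠ 0) = B at *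
  have hodd' : ∀ a b : ℂ, br (a - b) ≠ 0 → br (b - a) ≠ 0 := fun a b h => by
    rw [← neg_sub, hodd]; exact neg_ne_zero.2 h
  obtain ⟨hy0, -, hyfac, -, hxy3⟩ := hD (l, ∅) (by simp)
  obtain ⟨hx0, -, hxfac, -, hxy4⟩ := hH (l, ∅) (ν, ∅) (by simp [add_comm])
  simp only [xshiftI, yshiftMu, notMem_empty, if_false, mul_zero, add_zero] at hx0 hxfac hxy4
  have hx : ∀ i j, i ≠ j → br (x i - x j) ≠ 0 := fun i j hij =>
    (lt_or_gt_of_ne hij).elim (hx0 i j) fun h => hodd' _ _ (hx0 j i h)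
  have hyne : ∀ i j, i ≠ j → br (y i - y j) ≠ 0 := fun i j hij =>
    (lt_or_gt_of_ne hij).elim (hy0 i j) fun h => hodd' _ _ (hy0 j i h)
  have hysub : ∀ i j, ∀ s : ℕ, s + 1 ≤ l i → br (y i - y j - (s + 1) * κ) ≠ 0 := fun i j s hs => by
    have h := hyfac i j
    rw [sfac_natCast, prod_ne_zero_iff] at h
    convert h s (mem_range.2 hs) using 2
    ring
  have hy : ∀ i j, i ≠ j → ∀ a b : ℕ, a ≤ l i → b ≤ l j →
      br (y i - y j - ((a : ℂ) - b) * κ) ≠ 0 := fun i j hij a b ha hb => by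
    rcases lt_trichotomy a b with h | rfl | h
    · obtain ⟨s, rfl⟩ := Nat.exists_eq_add_of_lt h
      have := hysub j i s (by omega)
      rw [← neg_ne_zero, ← hodd] at this
      convert this using 2
      push_cast
      ring
    · convert hyne i j hij using 2
      ring
    · obtain ⟨s, rfl⟩ := Nat.exists_eq_add_of_lt h
      convert hysub i j s (by omega) using 2
      push_cast
      ring
  have h₃ : ∀ i j, br (x i - y j + l j * κ - κ) ≠ 0 := fun i j => by
    have := hxy3 j i (by simp)
    rw [← neg_ne_zero, ← hodd] at this
    convert this using 2
    ring
  have h₄ : ∀ i j, br (x i - y j + l j * κ + ν i * δ - δ) ≠ 0 := fun i j => by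
    convert hxy4 i j (by simp) using 2
    ring
  have h₁ : ∀ i ∈ A, ∀ j, br (x i - y j + l j * κ) ≠ 0 := fun i hi j => by
    have hle := single_le_sum (f := ν) (fun _ _ => Nat.zero_le _) (mem_univ i)
    have hne := (hA i).1 hi
    have := (hD (l, {i}) (by simp only [card_singleton]; omega)).2.2.2.1 j i (by simp)
    rw [← neg_ne_zero, ← hodd] at this
    convert this using 2
    ring
  have hsum : ∀ j ∈ B, (∑ j', (l j' - if j' ∈ ({j} : Finset (Fin r)) then 1 else 0)) + 1 = ∑ j', l j' :=
    fun j hj => sum_sub_indicator l {j} (by simpa using (hB j).1 hj)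
  have hcast : ∀ j ∈ B, ((l j - if j ∈ ({j} : Finset (Fin r)) then 1 else 0 : ℕ) : ℂ) = l j - 1 :=
    fun j hj => by
      rw [if_pos (mem_singleton_self j), Nat.cast_sub (Nat.one_le_iff_ne_zero.2 ((hB j).1 hj)),
        Nat.cast_one]
  have h₂ : ∀ i, ∀ j ∈ B, br (x i - y j + l j * κ - 2 * κ) ≠ 0 := fun i j hj => by
    have hs := hsum j hj
    have := (hD (fun j' => l j' - if j' ∈ ({j} : Finset (Fin r)) then 1 else 0, ∅)
      (by simp only [card_empty]; omega)).2.2.2.2 j i (by simp)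
    rw [hcast j hj, ← neg_ne_zero, ← hodd] at this
    convert this using 2
    ring
  have h₅ : ∀ i, ∀ j ∈ B, br (x i - y j + l j * κ + ν i * δ - κ) ≠ 0 := fun i j hj => by
    have hs := hsum j hj
    have := (hH (fun j' => l j' - if j' ∈ ({j} : Finset (Fin r)) then 1 else 0, ∅) (ν, {j})
      (by simp only [card_empty, card_singleton]; omega)).2.2.2.1 i j (by simp)
    simp only [xshiftI, yshiftMu, hcast j hj, notMem_empty, if_false] at this
    convert this using 2
    ring
  obtain ⟨P, hP⟩ := exists_coef_mul_coef_eq hodd δ κ x y ν l A B hA hB hx hxfac hy hyfac h₁ h₂ h₃ h₄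
    h₅ rfl rfl
  have key := sum_sum_pairFactor_eq_zero hodd hent hnz hW (κ - δ) A B
    (Sum.elim x fun j => y j - l j * κ + κ) (Sum.elim (fun i => x i + ν i * δ) fun j => y j + δ)
    (fun i _ j _ hij => hx i j hij)
    (fun i _ j _ => by
      simp only [Sum.elim_inl, Sum.elim_inr]
      convert h₃ i j using 2
      ring)
    (fun i _ j _ hij => by
      simp only [Sum.elim_inr]
      convert hy i j hij _ _ le_rfl le_rfl using 2
      ring)
  rw [← mul_zero P, ← key, mul_sum]
  refine sum_congr rfl fun p hp => ?_
  obtain ⟨hpA, hpB⟩ := mem_product.1 hp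
  rw [mem_powerset] at hpA hpB
  rw [hP p.1 p.2 _ _ (fun i => ?_) (fun j => ?_)]
  · have hsA : ∑ i ∈ A, (ν i : ℂ) = ∑ i, (ν i : ℂ) :=
      sum_subset (subset_univ A) fun i _ hi => by simpa using (hA i).not.1 hi
    have hsB : ∑ j ∈ B, (l j : ℂ) = ∑ j, (l j : ℂ) :=
      sum_subset (subset_univ B) fun j _ hj => by simpa using (hB j).not.1 hj
    have harg : ((p.1.card : ℂ) - p.2.card + ∑ j, (l j : ℂ)) * κ
          + ((p.2.card : ℂ) - p.1.card + ∑ i, (ν i : ℂ)) * δ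
        = ((p.1.card : ℂ) - p.2.card + B.card) * (κ - δ)
          + (∑ i ∈ A, (x i + ν i * δ - x i) + ∑ j ∈ B, (y j + δ - (y j - l j * κ + κ))) := by
      have e1 : ∀ i, x i + ν i * δ - x i = ν i * δ := fun i => by ring
      have e2 : ∀ j, y j + δ - (y j - l j * κ + κ) = l j * κ - (κ - δ) := fun j => by ring
      simp only [e1, e2, sum_sub_distrib, ← sum_mul, hsA, hsB, sum_const, nsmul_eq_mul]
      ring
    rw [harg]
    simp only [Sum.elim_inl, Sum.elim_inr]
    ring
  · refine (Nat.sub_add_cancel ?_).symm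
    split_ifs with h
    · exact Nat.one_le_iff_ne_zero.2 ((hA i).1 (hpA h))
    · exact Nat.zero_le _
  · refine (Nat.sub_add_cancel ?_).symm
    split_ifs with h
    · exact Nat.one_le_iff_ne_zero.2 ((hB j).1 (hpB h))
    · exact Nat.zero_le _

/-- Wronski relation:
`Σ_{k+l=K} [kκ + lδ] · D_{m,r}^{(k)} H_{m,r}^{(l)} = 0` for `K ≥ 1`,
at every admissible point. -/
theorem wronski_relation
    (br : ℂ → ℂ) (hodd : ∀ z : ℂ, br (-z) = -br z)
    (hent : Differentiable ℂ br) (hnz : br ≠ 0)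
    (hW : ∀ a b c d : ℂ,
      br (a + b) * br (a - b) * br (c + d) * br (c - d)
        + br (a + d) * br (a - d) * br (b + c) * br (b - c)
        = br (a + c) * br (a - c) * br (b + d) * br (b - d))
    (δ κ : ℂ)
    (hδ : ∀ n : ℕ, 1 ≤ n → br ((n : ℂ) * δ) ≠ 0)
    (hκ : ∀ n : ℕ, 1 ≤ n → br ((n : ℂ) * κ) ≠ 0)
    (m r K : ℕ) (hK : 1 ≤ K) (F : (Fin m → ℂ) → (Fin r → ℂ) → ℂ)
    (x : Fin m → ℂ) (y : Fin r → ℂ)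
    (hD : ∀ k ∈ Finset.range (K + 1), ∀ p ∈ idxSet r m k,
      CDenomNZ br (-κ) p.1 p.2 y x)
    (hH : ∀ k ∈ Finset.range (K + 1), ∀ p ∈ idxSet r m k,
      ∀ q ∈ idxSet m r (K - k),
        CDenomNZ br δ q.1 q.2 (xshiftI δ p.2 x) (yshiftMu κ p.1 y)) :
    ∑ k ∈ Finset.range (K + 1),
        br ((k : ℂ) * κ + ((K - k : ℕ) : ℂ) * δ)
          * Dop br δ κ m r k (fun x' y' => Hop br δ κ m r (K - k) F x' y') x y
      = 0 := by
  have hD' : ∀ p : (Fin r → ℕ) × Finset (Fin m), (∑ j, p.1 j) + p.2.card ≤ K →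
      CDenomNZ br (-κ) p.1 p.2 y x := fun p hp =>
    hD _ (mem_range.2 (Nat.lt_succ_of_le hp)) p (mem_idxSet.2 rfl)
  have hH' : ∀ (p : (Fin r → ℕ) × Finset (Fin m)) (q : (Fin m → ℕ) × Finset (Fin r)),
      (∑ j, p.1 j) + p.2.card + ((∑ i, q.1 i) + q.2.card) = K →
      CDenomNZ br δ q.1 q.2 (xshiftI δ p.2 x) (yshiftMu κ p.1 y) := fun p q hpq =>
    hH _ (mem_range.2 (by omega)) p (mem_idxSet.2 rfl) q (mem_idxSet.2 (by omega))
  simp only [Dop, Hop, mul_sum]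
  rw [sum_sigma', sum_sigma']
  set T := ((range (K + 1)).sigma fun k => idxSet r m k).sigma
    fun s => idxSet m r (K - s.1) with hT
  have hmem : ∀ s, s ∈ T ↔ (∑ j, s.1.2.1 j) + s.1.2.2.card = s.1.1 ∧
      (∑ i, s.2.1 i) + s.2.2.card + s.1.1 = K := fun s => by
    simp only [hT, mem_sigma, mem_range, mem_idxSet]
    omega
  clear_value T
  let g : (Σ _ : (Σ _ : ℕ, (Fin r → ℕ) × Finset (Fin m)), (Fin m → ℕ) × Finset (Fin r)) →
      (Fin m → ℕ) × (Fin r → ℕ) := fun s =>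
    (fun i => s.2.1 i + if i ∈ s.1.2.2 then 1 else 0, fun j => s.1.2.1 j + if j ∈ s.2.2 then 1 else 0)
  rw [← sum_fiberwise_of_maps_to (t := T.image g) (g := g) fun s hs => mem_image_of_mem g hs]
  refine sum_eq_zero fun a ha => ?_
  obtain ⟨s₀, hs₀, rfl⟩ := mem_image.1 ha
  have hsum : (∑ i, (g s₀).1 i) + ∑ j, (g s₀).2 j = K := by
    have := (hmem s₀).1 hs₀
    simp only [g, sum_add_distrib, sum_boole, filter_mem_eq_inter, univ_inter, Nat.cast_id]
    omega
  generalize g s₀ = w at hsum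
  obtain ⟨ν, l⟩ := w
  simp only at hsum
  have hzero := sum_coef_mul_coef_eq_zero hodd hent hnz hW δ κ x y ν l
    (fun p hp => hD' p (hsum ▸ hp)) (fun p q hpq => hH' p q (hpq.trans hsum))
  rw [← zero_mul (F (xshift δ ν x) (yshiftMu κ l y)), ← hzero, sum_mul]
  have hfib : ∀ s ∈ T.filter fun s => g s = (ν, l),
      s ∈ T ∧ (∀ i, ν i = s.2.1 i + if i ∈ s.1.2.2 then 1 else 0) ∧
        ∀ j, l j = s.1.2.1 j + if j ∈ s.2.2 then 1 else 0 := fun s hs => by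
    obtain ⟨hsT, hg⟩ := mem_filter.1 hs
    obtain ⟨rfl, rfl⟩ := Prod.mk.inj hg
    exact ⟨hsT, fun _ => rfl, fun _ => rfl⟩
  refine sum_bij' (fun s _ => (s.1.2.2, s.2.2))
    (fun p _ => ⟨⟨p.1.card + ∑ j, (l j - if j ∈ p.2 then 1 else 0),
      fun j => l j - if j ∈ p.2 then 1 else 0, p.1⟩, fun i => ν i - if i ∈ p.1 then 1 else 0, p.2⟩)
    ?_ ?_ ?_ ?_ ?_
  · intro s hs
    obtain ⟨-, hν, hl⟩ := hfib s hs
    simp only [mem_product, mem_powerset]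
    exact ⟨fun i hi => by simp [hν, hi], fun j hj => by simp [hl, hj]⟩
  · intro p hp
    obtain ⟨hpA, hpB⟩ := mem_product.1 hp
    rw [mem_powerset] at hpA hpB
    have hA : ∀ i ∈ p.1, ν i ≠ 0 := fun i hi => by simpa using hpA hi
    have hB : ∀ j ∈ p.2, l j ≠ 0 := fun j hj => by simpa using hpB hj
    have h1 := sum_sub_indicator ν p.1 hA
    have h2 := sum_sub_indicator l p.2 hB
    refine mem_filter.2 ⟨(hmem _).2 ⟨add_comm _ _, by simp only; omega⟩, ?_⟩
    refine Prod.ext (funext fun i => Nat.sub_add_cancel ?_) (funext fun j => Nat.sub_add_cancel ?_)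
    · split_ifs with h
      · exact Nat.one_le_iff_ne_zero.2 (hA i h)
      · exact Nat.zero_le _
    · split_ifs with h
      · exact Nat.one_le_iff_ne_zero.2 (hB j h)
      · exact Nat.zero_le _
  · intro s hs
    obtain ⟨hsT, hν, hl⟩ := hfib s hs
    have hk := ((hmem s).1 hsT).1
    obtain ⟨⟨k, μ, I⟩, ρ, J⟩ := s
    simp only at hν hl hk
    have h1 : (fun j => l j - if j ∈ J then 1 else 0) = μ := funext fun j => by rw [hl j]; omega
    have h2 : (fun i => ν i - if i ∈ I then 1 else 0) = ρ := funext fun i => by rw [hν i]; omega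
    have h3 : I.card + univ.sum μ = k := by rw [← hk, add_comm]
    simp only [h1, h2, h3]
  · intro p hp
    rfl
  · intro s hs
    obtain ⟨hsT, hν, hl⟩ := hfib s hs
    obtain ⟨hk, hk'⟩ := (hmem s).1 hsT
    obtain ⟨⟨k, μ, I⟩, ρ, J⟩ := s
    simp only at hν hl hk hk' ⊢
    have h1 : (fun j => l j - if j ∈ J then 1 else 0) = μ := funext fun j => by rw [hl j]; omega
    have h2 : (fun i => ν i - if i ∈ I then 1 else 0) = ρ := funext fun i => by rw [hν i]; omega
    have hx : xshift δ ρ (xshiftI δ I x) = xshift δ ν x := funext fun i => by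
      simp only [xshift, xshiftI, hν i]; push_cast; ring
    have hy : yshift κ J (yshiftMu κ μ y) = yshiftMu κ l y := funext fun j => by
      simp only [yshift, yshiftMu, hl j]; push_cast; ring
    have hlsum : ∑ j, (l j : ℂ) = ∑ j, (μ j : ℂ) + J.card := by
      simp [hl, sum_add_distrib]
    have hνsum : ∑ i, (ν i : ℂ) = ∑ i, (ρ i : ℂ) + I.card := by
      simp [hν, sum_add_distrib]
    have hKk : K - k = (∑ i, ρ i) + J.card := by omega
    rw [h1, h2, hx, hy, hlsum, hνsum, hKk, ← hk]
    push_cast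
    ring_nf
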